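/- arXiv:2004.09310 — 2 statements merged into one kernel-verified Lean document; each statement's English description precedes it below -/
import Mathlib

section
/- Let d ≥ 4 and n ≥ 2. For generic f ∈ S^d the following holds: (a) for every nonzero linear form x ∈ S^1, x^d ∉ J_f^d (i.e., x^d is nonzero in R_f^d); (b) for any nonzero linear forms x, y ∈ S^1, if the classes of x^d and y^d in R_f^d are linearly dependent (i.e., x^d − λ y^d ∈ J_f^d for some λ ∈ ℂ), then x and y are proportional. In particular the map x ↦ x^d mod J_f induces an injection from P(S^1) to P(R_f^d). -/
open MvPolynomial

noncomputable section

abbrev S (n : ℕ) : Type := MvPolynomial (Fin (n + 1)) ℂ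

/-- The Jacobian ideal of `f`, generated by its partial derivatives. -/
def jacobianIdeal {n : ℕ} (f : S n) : Ideal (S n) :=
  Ideal.span (Set.range fun i => MvPolynomial.pderiv i f)

/-- The degree-`k` graded piece of `S/I`: the image of the homogeneous degree-`k`
polynomials in the quotient. -/
def quotPiece {n : ℕ} (I : Ideal (S n)) (k : ℕ) : Submodule ℂ (S n ⧸ I) :=
  (MvPolynomial.homogeneousSubmodule (Fin (n + 1)) ℂ k).map
    (Ideal.Quotient.mkₐ ℂ I).toLinearMap

/-- The degree-`k` graded piece `R_f^k` of the Jacobian ring `R_f = S/J_f`. -/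
def Rpiece {n : ℕ} (f : S n) (k : ℕ) : Submodule ℂ (S n ⧸ jacobianIdeal f) :=
  quotPiece (jacobianIdeal f) k

/-- `f` defines a smooth hypersurface: its partial derivatives have no common
zero in `ℂ^{n+1} \ {0}`. -/
def SmoothHyp {n : ℕ} (f : S n) : Prop :=
  ∀ v : Fin (n + 1) → ℂ, (∀ i, MvPolynomial.eval v (MvPolynomial.pderiv i f) = 0) → v = 0

/-- A polynomial function on a complex vector space: an element of the algebra of
functions generated by the linear functionals. -/
def IsPolyFun {M : Type} [AddCommGroup M] [Module ℂ M] (φ : M → ℂ) : Prop :=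
  φ ∈ Algebra.adjoin ℂ {ψ : M → ℂ | ∃ l : M →ₗ[ℂ] ℂ, ψ = ⇑l}

/-- A property `P` holds for generic points of `M`: it holds on a nonempty
Zariski-open subset, i.e. on the nonvanishing locus of some polynomial function
that is not identically zero. -/
def GenericallyHolds {M : Type} [AddCommGroup M] [Module ℂ M] (P : M → Prop) : Prop :=
  ∃ φ : M → ℂ, IsPolyFun φ ∧ (∃ x, φ x ≠ 0) ∧ ∀ x, φ x ≠ 0 → P x

/-- Substitution of the linear change of coordinates given by the matrix `A`. -/
def substLin {n : ℕ} (A : Matrix (Fin (n + 1)) (Fin (n + 1)) ℂ) (f : S n) : S n :=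
  MvPolynomial.aeval (fun i => ∑ j, A i j • MvPolynomial.X j) f

/-- A regular sequence: each `f i` is a nonzerodivisor modulo the previous ones. -/
def IsRegularSeq {n c : ℕ} (f : Fin c → S n) : Prop :=
  ∀ (i : Fin c) (g : S n),
    f i * g ∈ Ideal.span (f '' {j | j < i}) → g ∈ Ideal.span (f '' {j | j < i})

/-- Zariski-closed subset of a complex vector space: common zero locus of a set of
polynomial functions. -/
def IsZariskiClosed {M : Type} [AddCommGroup M] [Module ℂ M] (T : Set M) : Prop :=
  ∃ 𝒮 : Set (M → ℂ), (∀ φ ∈ 𝒮, IsPolyFun φ) ∧ T = {x | ∀ φ ∈ 𝒮, φ x = 0}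

/-- An irreducible Zariski-closed subset. -/
def IsIrredClosed {M : Type} [AddCommGroup M] [Module ℂ M] (Z : Set M) : Prop :=
  IsZariskiClosed Z ∧ Z.Nonempty ∧
    ∀ C₁ C₂ : Set M, IsZariskiClosed C₁ → IsZariskiClosed C₂ →
      Z ⊆ C₁ ∪ C₂ → Z ⊆ C₁ ∨ Z ⊆ C₂

/-- The (Krull) dimension of the algebraic set `T` is at least `m`: there is a strictly
increasing chain of `m+1` irreducible closed subsets contained in `T`. -/
def algDimGE {M : Type} [AddCommGroup M] [Module ℂ M] (T : Set M) (m : ℕ) : Prop :=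
  ∃ Z : Fin (m + 1) → Set M, StrictMono Z ∧ (∀ i, IsIrredClosed (Z i)) ∧
    Z (Fin.last m) ⊆ T

theorem IsPolyFun.of_linear {M : Type} [AddCommGroup M] [Module ℂ M] (l : M →ₗ[ℂ] ℂ) :
    IsPolyFun (fun f => l f) :=
  Algebra.subset_adjoin ⟨l, rfl⟩

theorem IsPolyFun.const {M : Type} [AddCommGroup M] [Module ℂ M] (c : ℂ) :
    IsPolyFun (fun _ : M => c) :=
  Subalgebra.algebraMap_mem _ c

theorem IsPolyFun.mul {M : Type} [AddCommGroup M] [Module ℂ M] {φ ψ : M → ℂ}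
    (hφ : IsPolyFun φ) (hψ : IsPolyFun ψ) : IsPolyFun (fun f => φ f * ψ f) :=
  Subalgebra.mul_mem _ hφ hψ

theorem IsPolyFun.sum {M : Type} [AddCommGroup M] [Module ℂ M] {ι : Type*} (s : Finset ι)
    {φ : ι → M → ℂ} (hφ : ∀ i ∈ s, IsPolyFun (φ i)) : IsPolyFun (fun f => ∑ i ∈ s, φ i f) := by
  have h := Subalgebra.sum_mem (Algebra.adjoin ℂ {ψ : M → ℂ | ∃ l : M →ₗ[ℂ] ℂ, ψ = ⇑l}) hφ
  have e : (fun f => ∑ i ∈ s, φ i f) = ∑ i ∈ s, φ i := by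
    ext f; simp
  rw [e]; exact h

theorem IsPolyFun.prod {M : Type} [AddCommGroup M] [Module ℂ M] {ι : Type*} (s : Finset ι)
    {φ : ι → M → ℂ} (hφ : ∀ i ∈ s, IsPolyFun (φ i)) : IsPolyFun (fun f => ∏ i ∈ s, φ i f) := by
  have h := Subalgebra.prod_mem (Algebra.adjoin ℂ {ψ : M → ℂ | ∃ l : M →ₗ[ℂ] ℂ, ψ = ⇑l}) hφ
  have e : (fun f => ∏ i ∈ s, φ i f) = ∏ i ∈ s, φ i := by
    ext f; simp
  rw [e]; exact h

theorem IsPolyFun.det {M : Type} [AddCommGroup M] [Module ℂ M] {T : Type*} [Fintype T]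
    [DecidableEq T] {B : M → Matrix T T ℂ} (hB : ∀ s t, IsPolyFun (fun f => B f s t)) :
    IsPolyFun (fun f => (B f).det) := by
  simp only [Matrix.det_apply']
  exact IsPolyFun.sum _ fun σ _ => (IsPolyFun.const _).mul (IsPolyFun.prod _ fun i _ => hB _ _)

/-- A family of polynomials whose coefficients are polynomial functions of the parameter. -/
def IsPolyFamily {M : Type} [AddCommGroup M] [Module ℂ M] {V : Type*}
    (P : M → MvPolynomial V ℂ) : Prop :=
  ∀ m, IsPolyFun (fun f => coeff m (P f))

theorem IsPolyFamily.const {M : Type} [AddCommGroup M] [Module ℂ M] {V : Type*}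
    (p : MvPolynomial V ℂ) : IsPolyFamily (fun _ : M => p) :=
  fun _ => IsPolyFun.const _

theorem IsPolyFamily.C {M : Type} [AddCommGroup M] [Module ℂ M] {V : Type*} {φ : M → ℂ}
    (hφ : IsPolyFun φ) : IsPolyFamily (fun f => (MvPolynomial.C (φ f) : MvPolynomial V ℂ)) := by
  classical
  intro m
  by_cases h : 0 = m
  · simpa [coeff_C, h] using hφ
  · simpa [coeff_C, h] using IsPolyFun.const 0

theorem IsPolyFamily.mul {M : Type} [AddCommGroup M] [Module ℂ M] {V : Type*}
    {P Q : M → MvPolynomial V ℂ} (hP : IsPolyFamily P) (hQ : IsPolyFamily Q) :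
    IsPolyFamily (fun f => P f * Q f) := by
  classical
  intro m
  simp only [coeff_mul]
  exact IsPolyFun.sum _ fun x _ => (hP _).mul (hQ _)

theorem IsPolyFamily.sum {M : Type} [AddCommGroup M] [Module ℂ M] {V ι : Type*} (s : Finset ι)
    {P : ι → M → MvPolynomial V ℂ} (hP : ∀ i ∈ s, IsPolyFamily (P i)) :
    IsPolyFamily (fun f => ∑ i ∈ s, P i f) := by
  intro m
  simp only [coeff_sum]
  exact IsPolyFun.sum _ fun i hi => hP i hi m

theorem IsPolyFamily.prod {M : Type} [AddCommGroup M] [Module ℂ M] {V ι : Type*} (s : Finset ι)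
    {P : ι → M → MvPolynomial V ℂ} (hP : ∀ i ∈ s, IsPolyFamily (P i)) :
    IsPolyFamily (fun f => ∏ i ∈ s, P i f) := by
  classical
  induction s using Finset.induction_on with
  | empty => simpa using IsPolyFamily.const 1
  | insert a s ha ih =>
    simp only [Finset.prod_insert ha]
    exact (hP a (Finset.mem_insert_self _ _)).mul
      (ih fun i hi => hP i (Finset.mem_insert_of_mem hi))

theorem IsPolyFamily.det {M : Type} [AddCommGroup M] [Module ℂ M] {V T : Type*} [Fintype T]
    [DecidableEq T] {B : M → Matrix T T (MvPolynomial V ℂ)}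
    (hB : ∀ s t, IsPolyFamily (fun f => B f s t)) :
    IsPolyFamily (fun f => (B f).det) := by
  simp only [Matrix.det_apply']
  exact IsPolyFamily.sum _ fun σ _ =>
    (IsPolyFamily.const _).mul (IsPolyFamily.prod _ fun i _ => hB _ _)

theorem degree_eq_of_coeff_ne_zero {V : Type*} {p : MvPolynomial V ℂ} {k : ℕ}
    (hp : p.IsHomogeneous k) {m : V →₀ ℕ} (hm : coeff m p ≠ 0) : m.degree = k := by
  rw [Finsupp.degree_eq_weight_one]
  exact hp hm

theorem homogeneousComponent_mul_of_isHomogeneous {V : Type*} {p : MvPolynomial V ℂ} {k : ℕ}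
    (hp : p.IsHomogeneous k) (h : MvPolynomial V ℂ) (D : ℕ) :
    homogeneousComponent (D + k) (h * p) = homogeneousComponent D h * p := by
  classical
  ext m
  by_cases hm : m.degree = D + k
  · rw [coeff_homogeneousComponent, if_pos hm, coeff_mul, coeff_mul]
    refine Finset.sum_congr rfl fun x hx => ?_
    rw [Finset.HasAntidiagonal.mem_antidiagonal] at hx
    by_cases h2 : coeff x.2 p = 0
    · simp [h2]
    · have h3 : x.2.degree = k := degree_eq_of_coeff_ne_zero hp h2
      have h4 : x.1.degree = D := by
        have : x.1.degree + x.2.degree = D + k := by rw [← hm, ← hx, map_add]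
        omega
      rw [coeff_homogeneousComponent, if_pos h4]
  · rw [coeff_homogeneousComponent, if_neg hm]
    by_contra hne
    exact hm (degree_eq_of_coeff_ne_zero ((homogeneousComponent_isHomogeneous D h).mul hp)
      (Ne.symm hne))

theorem exists_pow_eq_sum {V ι : Type} [Fintype V] (P : ι → MvPolynomial V ℂ)
    {k : ℕ} (hP : ∀ i, (P i).IsHomogeneous k)
    (h0 : ∀ A : V → ℂ, (∀ i, eval A (P i) = 0) → A = 0) :
    ∃ D : ℕ, ∀ v : V, ∃ c : ι →₀ MvPolynomial V ℂ, (∀ i, (c i).IsHomogeneous D) ∧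
      (X v : MvPolynomial V ℂ) ^ (D + k) = c.sum fun i a => a * P i := by
  classical
  have h1 : ∀ v : V, ∃ D : ℕ, (X v : MvPolynomial V ℂ) ^ D ∈ Ideal.span (Set.range P) := by
    intro v
    have : (X v : MvPolynomial V ℂ) ∈ (Ideal.span (Set.range P)).radical := by
      rw [← MvPolynomial.vanishingIdeal_zeroLocus_eq_radical (K := ℂ), mem_vanishingIdeal_iff]
      intro A hA
      have : A = 0 := by
        apply h0
        intro i
        have := hA (P i) (Ideal.subset_span ⟨i, rfl⟩)
        simpa [aeval_eq_eval] using this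
      simp [this]
    exact this
  choose D hD using h1
  refine ⟨∑ v, D v, fun v => ?_⟩
  have h2 : (X v : MvPolynomial V ℂ) ^ (∑ v, D v + k) ∈ Ideal.span (Set.range P) := by
    have : D v ≤ ∑ v, D v + k :=
      (Finset.single_le_sum (fun _ _ => Nat.zero_le _) (Finset.mem_univ v)).trans
        (Nat.le_add_right _ _)
    obtain ⟨e, he⟩ := Nat.exists_eq_add_of_le this
    rw [he, pow_add]
    exact Ideal.mul_mem_right _ _ (hD v)
  obtain ⟨c, hc⟩ := (Finsupp.mem_ideal_span_range_iff_exists_finsupp).1 h2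
  refine ⟨c.mapRange (homogeneousComponent (∑ v, D v)) (map_zero _), fun i => ?_, ?_⟩
  · exact homogeneousComponent_isHomogeneous _ _
  · have := congrArg (homogeneousComponent (∑ v, D v + k)) hc
    rw [homogeneousComponent_of_mem ((isHomogeneous_X_pow v _)), if_pos rfl] at this
    rw [← this, Finsupp.sum_mapRange_index (by simp), Finsupp.sum, Finsupp.sum, map_sum]
    exact Finset.sum_congr rfl fun i _ => homogeneousComponent_mul_of_isHomogeneous (hP i) _ _

/-- Elimination: having no nontrivial common zero is an open condition on the parameters of a
family of homogeneous polynomials. -/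
theorem exists_isPolyFun_forall_common_zero_eq_zero {M : Type} [AddCommGroup M] [Module ℂ M]
    {V ι : Type} [Fintype V] [Nonempty V] (P : ι → M → MvPolynomial V ℂ) {k : ℕ}
    (hP : ∀ i f, (P i f).IsHomogeneous k) (hc : ∀ i, IsPolyFamily (P i)) (f₀ : M)
    (h0 : ∀ A : V → ℂ, (∀ i, eval A (P i f₀) = 0) → A = 0) :
    ∃ φ : M → ℂ, IsPolyFun φ ∧ φ f₀ ≠ 0 ∧
      ∀ f, φ f ≠ 0 → ∀ A : V → ℂ, (∀ i, eval A (P i f) = 0) → A = 0 := by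
  classical
  obtain ⟨D, hD⟩ := exists_pow_eq_sum (fun i => P i f₀) (fun i => hP i f₀) h0
  choose c hc1 hc2 using hD
  set E := D + k with hE
  set K := Fintype.card V * E with hK
  let T := (Finset.finsuppAntidiag (Finset.univ : Finset V) K : Finset (V →₀ ℕ))
  have hT : ∀ m : V →₀ ℕ, m ∈ T ↔ m.degree = K := by
    intro m
    simp [T, Finset.mem_finsuppAntidiag, Finsupp.degree_eq_sum]
  have hv : ∀ m : T, ∃ v, Finsupp.single v E ≤ m.1 := by
    intro m
    by_contra hcon
    push Not at hcon
    have h1 : ∀ v, m.1 v < E := by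
      intro v
      by_contra hlt
      exact hcon v (Finsupp.single_le_iff.2 (not_lt.1 hlt))
    have h2 : ∑ v, m.1 v < ∑ _v : V, E :=
      Finset.sum_lt_sum_of_nonempty Finset.univ_nonempty fun v _ => h1 v
    have h3 := (hT _).1 m.2
    rw [Finsupp.degree_eq_sum] at h3
    simp only [Finset.sum_const, Finset.card_univ, smul_eq_mul] at h2
    omega
  choose v hv using hv
  let G : V → M → MvPolynomial V ℂ := fun w f => (c w).sum fun i a => a * P i f
  have hG : ∀ w f, (G w f).IsHomogeneous E := fun w f =>
    IsHomogeneous.sum _ _ _ fun i _ => (hc1 w i).mul (hP i f)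
  have hG0 : ∀ w, G w f₀ = X w ^ E := fun w => (hc2 w).symm
  have hGp : ∀ w, IsPolyFamily (G w) := fun w =>
    IsPolyFamily.sum _ fun i _ => (IsPolyFamily.const _).mul (hc i)
  let R : T → M → MvPolynomial V ℂ :=
    fun m f => G (v m) f * monomial (m.1 - Finsupp.single (v m) E) 1
  have hR : ∀ m f, (R m f).IsHomogeneous K := by
    intro m f
    have h1 : (monomial (m.1 - Finsupp.single (v m) E) (1 : ℂ)).IsHomogeneous
        (m.1 - Finsupp.single (v m) E).degree := isHomogeneous_monomial _ rfl
    have h2 := (hG (v m) f).mul h1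
    have h3 : E + (m.1 - Finsupp.single (v m) E).degree = K := by
      rw [← (hT _).1 m.2]
      conv_rhs => rw [← tsub_add_cancel_of_le (hv m)]
      rw [map_add, Finsupp.degree_single, add_comm]
    rwa [h3] at h2
  let B : M → Matrix T T ℂ := fun f s t => coeff t.1 (R s f)
  refine ⟨fun f => (B f).det, IsPolyFun.det fun s t => ?_, ?_, fun f hf A hA => ?_⟩
  · exact ((hGp (v s)).mul (IsPolyFamily.const _)) t.1
  · have : B f₀ = 1 := by
      ext s t
      simp only [B, R, hG0, X_pow_eq_monomial, monomial_mul, coeff_monomial]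
      rw [add_tsub_cancel_of_le (hv s), Matrix.one_apply, one_mul]
      simp only [Subtype.ext_iff]
    simp [this]
  · have h1 : (B f).mulVec (fun t => t.1.prod fun v e => A v ^ e) = 0 := by
      ext s
      have h2 : eval A (R s f) = 0 := by
        simp only [R, G, map_mul, Finsupp.sum, map_sum, hA, mul_zero, Finset.sum_const_zero,
          zero_mul]
      rw [eval_eq] at h2
      simp only [Matrix.mulVec, dotProduct, B, Pi.zero_apply]
      rw [← h2]
      rw [Finset.sum_coe_sort T (fun t => coeff t (R s f) * t.prod fun v e => A v ^ e)]
      symm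
      refine Finset.sum_subset_zero_on_sdiff ?_ ?_ ?_
      · intro m hm
        rw [hT]
        exact degree_eq_of_coeff_ne_zero (hR s f) (mem_support_iff.1 hm)
      · intro m hm
        rw [notMem_support_iff.1 (Finset.mem_sdiff.1 hm).2, zero_mul]
      · intro m _
        rfl
    have h3 := Matrix.eq_zero_of_mulVec_eq_zero hf h1
    ext w
    have h4 : Finsupp.single w K ∈ T := by rw [hT, Finsupp.degree_single]
    have h5 := congrFun h3 ⟨_, h4⟩
    simp only [Pi.zero_apply] at h5
    rw [Finsupp.prod_single_index (by simp)] at h5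
    exact eq_zero_of_pow_eq_zero h5

section DividedCoefficients

variable {V : Type} [Fintype V] [DecidableEq V]

/-- The coefficient of `g` at the divided power monomial of exponent `m`. -/
def dividedCoeff (m : V →₀ ℕ) (g : MvPolynomial V ℂ) : ℂ :=
  (∏ i, ((m i).factorial : ℂ)) * coeff m g

/-- The linear vector field with matrix `A`, applied to `f`. -/
def linDer (A : V × V → ℂ) (f : MvPolynomial V ℂ) : MvPolynomial V ℂ :=
  ∑ i, ∑ j, C (A (i, j)) * (X j * pderiv i f)

/-- The action of a linear vector field on divided coefficients. -/
def shiftSum (A : V × V → ℂ) (F : (V →₀ ℕ) → ℂ) (m : V →₀ ℕ) : ℂ :=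
  ∑ i, ∑ j, A (i, j) * (m j * F (m - Finsupp.single j 1 + Finsupp.single i 1))

theorem prod_factorial_add_single (m : V →₀ ℕ) (i : V) :
    ∏ k, (((m + Finsupp.single i 1 : V →₀ ℕ) k).factorial : ℂ) =
      (m i + 1) * ∏ k, ((m k).factorial : ℂ) := by
  rw [← Finset.mul_prod_erase _ _ (Finset.mem_univ i),
    ← Finset.mul_prod_erase (a := i) _ (fun k => ((m k).factorial : ℂ)) (Finset.mem_univ i)]
  have h : ∏ k ∈ Finset.univ.erase i, (((m + Finsupp.single i 1 : V →₀ ℕ) k).factorial : ℂ) =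
      ∏ k ∈ Finset.univ.erase i, ((m k).factorial : ℂ) := by
    refine Finset.prod_congr rfl fun k hk => ?_
    simp [Finsupp.single_eq_of_ne (Finset.ne_of_mem_erase hk)]
  rw [h]
  simp only [Finsupp.add_apply, Finsupp.single_eq_same, Nat.factorial_succ]
  push_cast
  ring

theorem dividedCoeff_pderiv (m : V →₀ ℕ) (i : V) (f : MvPolynomial V ℂ) :
    dividedCoeff m (pderiv i f) = dividedCoeff (m + Finsupp.single i 1) f := by
  rw [dividedCoeff, dividedCoeff, prod_factorial_add_single, coeff_pderiv]
  ring

theorem dividedCoeff_X_mul (m : V →₀ ℕ) (j : V) (h : MvPolynomial V ℂ) :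
    dividedCoeff m (X j * h) = m j * dividedCoeff (m - Finsupp.single j 1) h := by
  rw [dividedCoeff, dividedCoeff, coeff_X_mul']
  by_cases hj : j ∈ m.support
  · rw [if_pos hj]
    have h1 : Finsupp.single j 1 ≤ m :=
      Finsupp.single_le_iff.2 (Nat.one_le_iff_ne_zero.2 (Finsupp.mem_support_iff.1 hj))
    have h2 := prod_factorial_add_single (m - Finsupp.single j 1) j
    rw [tsub_add_cancel_of_le h1] at h2
    rw [h2]
    have h3 : ((m - Finsupp.single j 1 : V →₀ ℕ) j : ℂ) + 1 = m j := by
      have : (m - Finsupp.single j 1 : V →₀ ℕ) j + 1 = m j := by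
        have := Finsupp.single_le_iff.1 h1
        simp only [Finsupp.tsub_apply, Finsupp.single_eq_same]
        omega
      exact_mod_cast this
    rw [h3]
    ring
  · rw [if_neg hj, Finsupp.notMem_support_iff.1 hj]
    simp

theorem dividedCoeff_linDer (A : V × V → ℂ) (f : MvPolynomial V ℂ) (m : V →₀ ℕ) :
    dividedCoeff m (linDer A f) = shiftSum A (fun m => dividedCoeff m f) m := by
  have h : ∀ i j, dividedCoeff m (C (A (i, j)) * (X j * pderiv i f)) =
      A (i, j) * (m j * dividedCoeff (m - Finsupp.single j 1 + Finsupp.single i 1) f) := by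
    intro i j
    rw [← dividedCoeff_pderiv, ← dividedCoeff_X_mul, dividedCoeff, dividedCoeff, coeff_C_mul]
    ring
  rw [shiftSum, linDer]
  simp only [← h]
  simp only [dividedCoeff, coeff_sum, Finset.mul_sum]

theorem dividedCoeff_linear_pow (a : V → ℂ) (d : ℕ) (m : V →₀ ℕ) (hm : m.degree = d) :
    dividedCoeff m ((∑ i, C (a i) * X i) ^ d) = d.factorial * ∏ i, a i ^ m i := by
  induction d generalizing m with
  | zero =>
    rw [Finsupp.degree_eq_zero_iff] at hm
    simp [hm, dividedCoeff]
  | succ d ih =>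
    have hne : m ≠ 0 := by
      rintro rfl
      simp at hm
    obtain ⟨i, hi⟩ := Finsupp.support_nonempty_iff.2 hne
    have h1 : Finsupp.single i 1 ≤ m :=
      Finsupp.single_le_iff.2 (Nat.one_le_iff_ne_zero.2 (Finsupp.mem_support_iff.1 hi))
    obtain ⟨m', rfl⟩ : ∃ m', m = m' + Finsupp.single i 1 := ⟨_, (tsub_add_cancel_of_le h1).symm⟩
    have h2 : pderiv i (∑ i, C (a i) * X i : MvPolynomial V ℂ) = C (a i) := by
      simp [pderiv_X, Pi.single_apply]
    have h3 : m'.degree = d := by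
      rw [map_add, Finsupp.degree_single] at hm
      omega
    have h4 : pderiv i ((∑ i, C (a i) * X i : MvPolynomial V ℂ) ^ (d + 1)) =
        C (((d : ℂ) + 1) * a i) * (∑ i, C (a i) * X i) ^ d := by
      rw [pderiv_pow, h2]
      simp
      ring
    rw [← dividedCoeff_pderiv, h4, dividedCoeff, coeff_C_mul]
    have h5 := ih m' h3
    rw [dividedCoeff] at h5
    rw [mul_left_comm, h5, Nat.factorial_succ]
    have h6 : ∏ k, a k ^ (m' + Finsupp.single i 1 : V →₀ ℕ) k = a i * ∏ k, a k ^ m' k := by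
      simp only [Finsupp.add_apply, pow_add, Finset.prod_mul_distrib]
      rw [mul_comm]
      congr 1
      rw [Finset.prod_eq_single i]
      · simp
      · intro k _ hk
        simp [Finsupp.single_eq_of_ne hk]
      · simp
    rw [h6]
    push_cast
    ring

/-- The `3 × 3` minors of a catalecticant matrix of `u ^ d - lam * v ^ d` vanish. -/
theorem det_dividedCoeff_eq_zero {d : ℕ} (hd : 2 ≤ d) (a b : V → ℂ) (lam : ℂ)
    (r c : Fin 3 → V →₀ ℕ) (hr : ∀ s, (r s).degree = 2) (hc : ∀ t, (c t).degree = d - 2) :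
    (Matrix.of fun s t => dividedCoeff (r s + c t)
      ((∑ i, C (a i) * X i) ^ d - lam • (∑ i, C (b i) * X i) ^ d)).det = 0 := by
  have h : ∀ s t, dividedCoeff (r s + c t)
      ((∑ i, C (a i) * X i) ^ d - lam • (∑ i, C (b i) * X i) ^ d) =
      d.factorial * ((∏ i, a i ^ r s i) * ∏ i, a i ^ c t i) -
        lam * (d.factorial * ((∏ i, b i ^ r s i) * ∏ i, b i ^ c t i)) := by
    intro s t
    have hst : (r s + c t).degree = d := by
      rw [map_add, hr, hc]
      omega
    have ha := dividedCoeff_linear_pow a d _ hst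
    have hb := dividedCoeff_linear_pow b d _ hst
    simp only [Finsupp.add_apply, pow_add, Finset.prod_mul_distrib] at ha hb
    rw [← ha, ← hb]
    simp only [dividedCoeff, coeff_sub, coeff_smul, smul_eq_mul]
    ring
  simp only [Matrix.det_fin_three, Matrix.of_apply, h]
  ring

theorem exists_dividedCoeff_eq (d : ℕ) (F : (V →₀ ℕ) → ℂ) :
    ∃ f : MvPolynomial V ℂ, f.IsHomogeneous d ∧ ∀ m, m.degree = d → dividedCoeff m f = F m := by
  refine ⟨∑ m ∈ Finset.finsuppAntidiag Finset.univ d,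
    monomial m (F m / ∏ i, ((m i).factorial : ℂ)), ?_, fun m hm => ?_⟩
  · refine IsHomogeneous.sum _ _ _ fun m hm => isHomogeneous_monomial _ ?_
    simpa [Finset.mem_finsuppAntidiag, Finsupp.degree_eq_sum] using hm
  · have h1 : m ∈ Finset.finsuppAntidiag (Finset.univ : Finset V) d := by
      simpa [Finset.mem_finsuppAntidiag, Finsupp.degree_eq_sum] using hm
    have h2 : (∏ i, ((m i).factorial : ℂ)) ≠ 0 :=
      Finset.prod_ne_zero_iff.2 fun i _ => Nat.cast_ne_zero.2 (Nat.factorial_ne_zero _)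
    rw [dividedCoeff, coeff_sum]
    simp only [coeff_monomial]
    rw [Finset.sum_ite_eq' , if_pos h1]
    field_simp

end DividedCoefficients

theorem shiftSum_congr {V : Type} [Fintype V] {d : ℕ} (A : V × V → ℂ) {F G : (V →₀ ℕ) → ℂ}
    (h : ∀ m, m.degree = d → F m = G m) {m : V →₀ ℕ} (hm : m.degree = d) :
    shiftSum A F m = shiftSum A G m := by
  refine Finset.sum_congr rfl fun i _ => Finset.sum_congr rfl fun j _ => ?_
  by_cases hj : m j = 0
  · simp [hj]
  · have h1 : Finsupp.single j 1 ≤ m := Finsupp.single_le_iff.2 (Nat.one_le_iff_ne_zero.2 hj)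
    rw [h]
    rw [← tsub_add_cancel_of_le h1, map_add, Finsupp.degree_single] at hm
    rw [map_add, Finsupp.degree_single, hm]

/-- All `3 × 3` minors of the catalecticant matrix of `G`, with rows in degree `2`, vanish. -/
def CatalecticantRankLE (d : ℕ) {V : Type} (G : (V →₀ ℕ) → ℂ) : Prop :=
  ∀ r c : Fin 3 → V →₀ ℕ, (∀ s, (r s).degree = 2) → (∀ t, (c t).degree = d - 2) →
    (Matrix.of fun s t => G (r s + c t)).det = 0

section HighDegree

variable {V : Type} {d : ℕ}

theorem exists_single_le_of_degree_pos {m : V →₀ ℕ} (h : 0 < m.degree) :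
    ∃ i m', m = Finsupp.single i 1 + m' := by
  have hne : m ≠ 0 := by
    rintro rfl
    simp at h
  obtain ⟨i, hi⟩ := Finsupp.support_nonempty_iff.2 hne
  have h1 : Finsupp.single i 1 ≤ m :=
    Finsupp.single_le_iff.2 (Nat.one_le_iff_ne_zero.2 (Finsupp.mem_support_iff.1 hi))
  exact ⟨i, m - Finsupp.single i 1, (add_tsub_cancel_of_le h1).symm⟩

theorem CatalecticantRankLE.eq_zero_of_forall_lt {G : (V →₀ ℕ) → ℂ}
    (hG : CatalecticantRankLE d G) {m : V →₀ ℕ} (hm : m.degree = d) (i : V) (h2 : 2 ≤ m i)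
    (hi : m i + 2 ≤ d) (h : ∀ m' : V →₀ ℕ, m'.degree = d → m i < m' i → G m' = 0) : G m = 0 := by
  classical
  obtain ⟨m₀, hm₀⟩ : ∃ m₀, m = Finsupp.single i (m i) + m₀ :=
    ⟨m - Finsupp.single i (m i), (add_tsub_cancel_of_le (Finsupp.single_le_iff.2 le_rfl)).symm⟩
  have h0 : m₀ i = 0 := by
    have := DFunLike.congr_fun hm₀ i
    simpa using this
  have hdeg : m i + m₀.degree = d := by
    rw [← hm, hm₀, map_add, Finsupp.degree_single, ← hm₀]
  obtain ⟨y, m₁, rfl⟩ := exists_single_le_of_degree_pos (m := m₀) (by omega)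
  rw [map_add, Finsupp.degree_single] at hdeg
  obtain ⟨z, m₂, rfl⟩ := exists_single_le_of_degree_pos (m := m₁) (by omega)
  rw [map_add, Finsupp.degree_single] at hdeg
  obtain ⟨e, he⟩ := Nat.exists_eq_add_of_le h2
  rw [he] at hm₀ hdeg h hi
  have hs : Finsupp.single i (2 + e) = Finsupp.single i 2 + Finsupp.single i e :=
    Finsupp.single_add _ _ _
  have hs2 : Finsupp.single i 2 = Finsupp.single i 1 + Finsupp.single i 1 := by
    rw [← Finsupp.single_add]
  have key := hG
    ![Finsupp.single i 2, Finsupp.single i 1 + Finsupp.single y 1,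
      Finsupp.single y 1 + Finsupp.single z 1]
    ![Finsupp.single i 2 + Finsupp.single i e + m₂,
      Finsupp.single i 1 + Finsupp.single z 1 + Finsupp.single i e + m₂,
      Finsupp.single y 1 + Finsupp.single z 1 + Finsupp.single i e + m₂]
    (by
      intro s
      fin_cases s <;> simp [map_add])
    (by
      intro t
      fin_cases t <;> simp [map_add] <;> omega)
  rw [Matrix.det_fin_three] at key
  simp only [Matrix.of_apply, Matrix.cons_val_zero, Matrix.cons_val_one, Matrix.cons_val] at key
  have e1 : G (Finsupp.single i 2 + (Finsupp.single i 2 + Finsupp.single i e + m₂)) = 0 := by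
    apply h
    · simp [map_add]; omega
    · simp; omega
  have e2 : G (Finsupp.single i 2 +
      (Finsupp.single i 1 + Finsupp.single z 1 + Finsupp.single i e + m₂)) = 0 := by
    apply h
    · simp [map_add]; omega
    · simp; omega
  have e3 : G (Finsupp.single i 1 + Finsupp.single y 1 +
      (Finsupp.single i 2 + Finsupp.single i e + m₂)) = 0 := by
    apply h
    · simp [map_add]; omega
    · simp; omega
  have e4 : Finsupp.single i 2 +
      (Finsupp.single y 1 + Finsupp.single z 1 + Finsupp.single i e + m₂) = m := by
    rw [hm₀, hs]; abel
  have e5 : Finsupp.single i 1 + Finsupp.single y 1 +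
      (Finsupp.single i 1 + Finsupp.single z 1 + Finsupp.single i e + m₂) = m := by
    rw [hm₀, hs, hs2]; abel
  have e6 : Finsupp.single y 1 + Finsupp.single z 1 +
      (Finsupp.single i 2 + Finsupp.single i e + m₂) = m := by
    rw [hm₀, hs]; abel
  rw [e1, e2, e3, e4, e5, e6] at key
  have : G m ^ 3 = 0 := by linear_combination -key
  exact eq_zero_of_pow_eq_zero this

open Classical in
/-- The indicator of the exponents of the monomials `X_j ^ (d - 3) * X_k ^ 2 * X_l`. -/
def tripleIndicator (d : ℕ) (V : Type) (m : V →₀ ℕ) : ℂ :=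
  if ∃ j k l, j ≠ k ∧ j ≠ l ∧ k ≠ l ∧
    m = Finsupp.single j (d - 3) + Finsupp.single k 2 + Finsupp.single l 1 then 1 else 0

theorem tripleIndicator_eq_one {j k l : V} (hjk : j ≠ k) (hjl : j ≠ l) (hkl : k ≠ l) :
    tripleIndicator d V
      (Finsupp.single j (d - 3) + Finsupp.single k 2 + Finsupp.single l 1) = 1 :=
  if_pos ⟨j, k, l, hjk, hjl, hkl, rfl⟩

theorem tripleIndicator_eq_zero_of_lt (hd : 5 ≤ d) {m : V →₀ ℕ} {i : V} (hi : d - 3 < m i) :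
    tripleIndicator d V m = 0 := by
  classical
  refine if_neg ?_
  rintro ⟨j, k, l, hjk, hjl, hkl, rfl⟩
  simp only [Finsupp.add_apply, Finsupp.single_apply] at hi
  split_ifs at hi <;> first | omega | simp_all

theorem tripleIndicator_eq_zero_of_pair (hd : 5 ≤ d) {m : V →₀ ℕ} {j k : V}
    (h : ∀ i, i ≠ j → i ≠ k → m i = 0) : tripleIndicator d V m = 0 := by
  classical
  refine if_neg ?_
  rintro ⟨j', k', l', hjk, hjl, hkl, rfl⟩
  have h1 := h j'
  have h2 := h k'
  have h3 := h l'
  simp [hjk, hjl, hkl, hjk.symm, hjl.symm, hkl.symm] at h1 h2 h3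
  have h1' : j' = j ∨ j' = k := by
    by_contra hc; push Not at hc
    have := h1 hc.1 hc.2; omega
  have h2' : k' = j ∨ k' = k := by
    by_contra hc; push Not at hc
    exact hc.2 (h2 hc.1)
  have h3' : l' = j ∨ l' = k := by
    by_contra hc; push Not at hc
    exact hc.2 (h3 hc.1)
  grind

variable [Fintype V]

theorem shiftSum_tripleIndicator_eq_zero_of_lt (hd : 5 ≤ d) (A : V × V → ℂ) {m : V →₀ ℕ} {i : V}
    (hi : d - 2 < m i) : shiftSum A (tripleIndicator d V) m = 0 := by
  classical
  refine Finset.sum_eq_zero fun p _ => Finset.sum_eq_zero fun q _ => ?_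
  rw [tripleIndicator_eq_zero_of_lt hd (i := i), mul_zero, mul_zero]
  simp only [Finsupp.add_apply, Finsupp.tsub_apply, Finsupp.single_apply]
  split_ifs <;> omega

theorem shiftSum_tripleIndicator_pair [DecidableEq V] (hd : 5 ≤ d) (A : V × V → ℂ) {j k : V}
    (hjk : j ≠ k) :
    shiftSum A (tripleIndicator d V) (Finsupp.single j (d - 2) + Finsupp.single k 2) =
      ((d - 2 : ℕ) : ℂ) * ((∑ p, if p = j then 0 else A (p, j)) - A (k, j)) := by
  have hval : ∀ p, tripleIndicator d V (Finsupp.single j (d - 3) + Finsupp.single k 2 +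
      Finsupp.single p 1) = if p = j ∨ p = k then 0 else 1 := by
    intro p
    by_cases hpj : p = j
    · rw [if_pos (Or.inl hpj)]
      subst hpj
      apply tripleIndicator_eq_zero_of_pair hd (j := p) (k := k)
      intro i hi1 hi2
      simp [Ne.symm hi1, Ne.symm hi2]
    by_cases hpk : p = k
    · rw [if_pos (Or.inr hpk)]
      subst hpk
      apply tripleIndicator_eq_zero_of_pair hd (j := j) (k := p)
      intro i hi1 hi2
      simp [Ne.symm hi1, Ne.symm hi2]
    rw [if_neg (by tauto)]
    exact tripleIndicator_eq_one hjk (Ne.symm hpj) (Ne.symm hpk)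
  have hinner : ∀ p, (∑ q, A (p, q) * (((Finsupp.single j (d - 2) + Finsupp.single k 2 : V →₀ ℕ) q
      : ℂ) * tripleIndicator d V (Finsupp.single j (d - 2) + Finsupp.single k 2 -
        Finsupp.single q 1 + Finsupp.single p 1))) =
      A (p, j) * (((d - 2 : ℕ) : ℂ) * if p = j ∨ p = k then 0 else 1) := by
    intro p
    rw [Finset.sum_eq_single j]
    · rw [← hval p]
      have : (Finsupp.single j (d - 2) + Finsupp.single k 2 - Finsupp.single j 1 : V →₀ ℕ) =
          Finsupp.single j (d - 3) + Finsupp.single k 2 := by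
        ext i
        simp only [Finsupp.add_apply, Finsupp.tsub_apply, Finsupp.single_apply]
        split_ifs <;> omega
      rw [this]
      simp [hjk.symm]
    · intro q _ hq
      by_cases hqk : q = k
      · rw [tripleIndicator_eq_zero_of_lt hd (i := j), mul_zero, mul_zero]
        simp [hqk, Finsupp.single_apply, hjk.symm]
        omega
      · simp [Ne.symm hq, Ne.symm hqk]
    · simp
  rw [shiftSum, Finset.sum_congr rfl fun p _ => hinner p]
  have hk : A (k, j) = ∑ p, if p = k then A (k, j) else 0 := by simp
  rw [hk, ← Finset.sum_sub_distrib, Finset.mul_sum]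
  refine Finset.sum_congr rfl fun p _ => ?_
  by_cases hpj : p = j
  · simp [hpj, hjk]
  · by_cases hpk : p = k
    · simp [hpk, hjk.symm]
    · simp [hpj, hpk]
      ring

theorem eq_zero_of_catalecticantRankLE_tripleIndicator (hd : 5 ≤ d) (hV : 3 ≤ Fintype.card V)
    (A : V × V → ℂ) (hA : CatalecticantRankLE d (shiftSum A (tripleIndicator d V))) : A = 0 := by
  classical
  have h1 : ∀ m : V →₀ ℕ, m.degree = d → ∀ i, d - 3 < m i →
      shiftSum A (tripleIndicator d V) m = 0 := by
    intro m hm i hi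
    by_cases hlt : d - 2 < m i
    · exact shiftSum_tripleIndicator_eq_zero_of_lt hd A hlt
    · exact hA.eq_zero_of_forall_lt hm i (by omega) (by omega) fun m' _ hm' =>
        shiftSum_tripleIndicator_eq_zero_of_lt hd A (i := i) (by omega)
  have h2 : ∀ m : V →₀ ℕ, m.degree = d → ∀ i, d - 3 ≤ m i →
      shiftSum A (tripleIndicator d V) m = 0 := by
    intro m hm i hi
    by_cases hlt : d - 3 < m i
    · exact h1 m hm i hlt
    · exact hA.eq_zero_of_forall_lt hm i (by omega) (by omega) fun m' hd' hm' =>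
        h1 m' hd' i (by omega)
  have hoff : ∀ k j, k ≠ j → A (k, j) = 0 := by
    intro k j hkj
    have h3 : ∀ k, k ≠ j → A (k, j) = ∑ p, if p = j then 0 else A (p, j) := by
      intro k hk
      have h4 := h2 (Finsupp.single j (d - 2) + Finsupp.single k 2)
        (by rw [map_add, Finsupp.degree_single, Finsupp.degree_single]; omega) j
        (by simp; omega)
      rw [shiftSum_tripleIndicator_pair hd A hk.symm] at h4
      have h5 : ((d - 2 : ℕ) : ℂ) ≠ 0 := Nat.cast_ne_zero.2 (by omega)
      have := (mul_eq_zero.1 h4).resolve_left h5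
      linear_combination -this
    set s := ∑ p, if p = j then 0 else A (p, j) with hs
    have h6 : s = Fintype.card V * s - s := by
      conv_lhs => rw [hs]
      have : ∀ p, (if p = j then 0 else A (p, j)) = s - if p = j then s else 0 := by
        intro p
        by_cases hp : p = j
        · simp [hp]
        · simp only [hp, if_false, sub_zero]
          exact h3 p hp
      rw [Finset.sum_congr rfl fun p _ => this p, Finset.sum_sub_distrib]
      simp
    rw [h3 k hkj]
    have h7 : ((Fintype.card V : ℂ) - 2) * s = 0 := by linear_combination -h6
    refine (mul_eq_zero.1 h7).resolve_left ?_
    rw [← ne_eq, sub_ne_zero]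
    exact_mod_cast (by omega : Fintype.card V ≠ 2)
  have hdiag : ∀ j k l, j ≠ k → j ≠ l → k ≠ l →
      ((d - 3 : ℕ) : ℂ) * A (j, j) + 2 * A (k, k) + A (l, l) = 0 := by
    intro j k l hjk hjl hkl
    have h3 := h2 (Finsupp.single j (d - 3) + Finsupp.single k 2 + Finsupp.single l 1)
      (by simp only [map_add, Finsupp.degree_single]; omega) j (by simp; omega)
    rw [← h3, shiftSum]
    have hinner : ∀ p, (∑ q, A (p, q) * (((Finsupp.single j (d - 3) + Finsupp.single k 2 +
        Finsupp.single l 1 : V →₀ ℕ) q : ℂ) * tripleIndicator d V (Finsupp.single j (d - 3) +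
          Finsupp.single k 2 + Finsupp.single l 1 - Finsupp.single q 1 + Finsupp.single p 1))) =
        (if p = j then ((d - 3 : ℕ) : ℂ) * A (j, j) else 0) +
          (if p = k then 2 * A (k, k) else 0) + if p = l then A (l, l) else 0 := by
      intro p
      rw [Finset.sum_eq_single p]
      · by_cases hz : (Finsupp.single j (d - 3) + Finsupp.single k 2 +
          Finsupp.single l 1 : V →₀ ℕ) p = 0
        · have e1 : p ≠ j := by
            rintro rfl
            simp at hz
            omega
          have e2 : p ≠ k := by
            rintro rfl
            simp at hz
          have e3 : p ≠ l := by
            rintro rfl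
            simp at hz
          rw [hz]
          simp [e1, e2, e3]
        · rw [tsub_add_cancel_of_le (Finsupp.single_le_iff.2 (Nat.one_le_iff_ne_zero.2 hz)),
            tripleIndicator_eq_one hjk hjl hkl, mul_one]
          simp only [Finsupp.add_apply, Finsupp.single_apply]
          by_cases e1 : p = j
          · subst e1
            simp [hjk, hjl, hjk.symm, hjl.symm]
            ring
          by_cases e2 : p = k
          · subst e2
            simp [e1, hkl, hkl.symm, Ne.symm e1]
            ring
          by_cases e3 : p = l
          · subst e3
            simp [e1, e2, Ne.symm e1, Ne.symm e2]
          simp [e1, e2, e3, Ne.symm e1, Ne.symm e2, Ne.symm e3]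
      · intro q _ hq
        rw [hoff p q (Ne.symm hq), zero_mul]
      · simp
    rw [Finset.sum_congr rfl fun p _ => hinner p]
    simp [Finset.sum_add_distrib]
  have heq : ∀ k l, k ≠ l → A (k, k) = A (l, l) := by
    intro k l hkl
    obtain ⟨j, hj⟩ : ∃ j, j ∉ ({k, l} : Finset V) := by
      by_contra hc
      push Not at hc
      have h3 : (Finset.univ : Finset V) ⊆ {k, l} := fun x _ => hc x
      have h4 := (Finset.card_le_card h3).trans Finset.card_le_two
      rw [Finset.card_univ] at h4
      omega
    simp only [Finset.mem_insert, Finset.mem_singleton, not_or] at hj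
    linear_combination hdiag j k l hj.1 hj.2 hkl - hdiag j l k hj.2 hj.1 hkl.symm
  ext ⟨p, q⟩
  by_cases hpq : p = q
  · subst hpq
    obtain ⟨k, hk⟩ : ∃ k, k ∉ ({p} : Finset V) := by
      by_contra hc
      push Not at hc
      have h3 : (Finset.univ : Finset V) ⊆ {p} := fun x _ => hc x
      have h4 := Finset.card_le_card h3
      rw [Finset.card_univ, Finset.card_singleton] at h4
      omega
    obtain ⟨l, hl⟩ : ∃ l, l ∉ ({p, k} : Finset V) := by
      by_contra hc
      push Not at hc
      have h3 : (Finset.univ : Finset V) ⊆ {p, k} := fun x _ => hc x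
      have h4 := (Finset.card_le_card h3).trans Finset.card_le_two
      rw [Finset.card_univ] at h4
      omega
    simp only [Finset.mem_insert, Finset.mem_singleton, not_or] at hk hl
    have h3 := hdiag p k l (Ne.symm hk) (Ne.symm hl.1) (Ne.symm hl.2)
    rw [heq k p hk, heq l p hl.1] at h3
    have h4 : (((d - 3 : ℕ) : ℂ) + 3) * A (p, p) = 0 := by linear_combination h3
    refine (mul_eq_zero.1 h4).resolve_left ?_
    exact_mod_cast (by omega : d - 3 + 3 ≠ 0)
  · exact hoff p q hpq

end HighDegree

section TernaryQuartic

/-- The catalecticant matrix of the image of the ternary quartic with divided coefficients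
`ternaryCoeff` under a linear vector field. -/
def ternaryCatalecticant (a z c t b m p q w : ℂ) : Matrix (Fin 6) (Fin 6) ℂ :=
  !![4 * t, 2 * z, 2 * a + 2 * w, q + c, 3 * p + m, 3 * a + b;
     2 * z, 0, 2 * b + 2 * q + 2 * w, 3 * q, p, 0;
     2 * a + 2 * w, 2 * b + 2 * q + 2 * w, 4 * m, b + 3 * m + 3 * w, t + 3 * c, t + p + z;
     q + c, 3 * q, b + 3 * m + 3 * w, 2 * b + 2 * q + 2 * w, t + p + z, p;
     3 * p + m, p, t + 3 * c, t + p + z, 2 * a + 2 * w, q + c;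
     3 * a + b, 0, t + p + z, p, q + c, 2 * z]

theorem eq_zero_of_ternaryCatalecticant_minors (a z c t b m p q w : ℂ)
    (h : ∀ r s : Fin 3 → Fin 6,
      ((ternaryCatalecticant a z c t b m p q w).submatrix r s).det = 0) :
    a = 0 ∧ z = 0 ∧ c = 0 ∧ t = 0 ∧ b = 0 ∧ m = 0 ∧ p = 0 ∧ q = 0 ∧ w = 0 := by
  simp only [Matrix.det_fin_three, Matrix.submatrix_apply] at h
  have h015 := h ![0, 1, 5] ![0, 1, 5]
  have h014 := h ![0, 1, 4] ![0, 1, 4]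
  have h013 := h ![0, 1, 3] ![0, 1, 3]
  have c1 := h ![1, 2, 3] ![1, 2, 3]
  have u1 := h ![2, 3, 4] ![3, 4, 5]
  have u2 := h ![0, 3, 4] ![3, 4, 5]
  have u3 := h ![0, 3, 4] ![0, 3, 4]
  have u4 := h ![0, 2, 3] ![0, 2, 3]
  have u5 := h ![2, 4, 5] ![2, 4, 5]
  have p0 := h ![0, 1, 4] ![1, 4, 5]
  have p1 := h ![1, 4, 5] ![1, 2, 3]
  have p2 := h ![1, 4, 5] ![1, 3, 4]
  have p3 := h ![0, 4, 5] ![1, 2, 3]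
  have p4 := h ![0, 4, 5] ![1, 3, 4]
  have p5 := h ![2, 3, 5] ![2, 3, 5]
  have p6 := h ![2, 4, 5] ![2, 4, 5]
  have q1 := h ![1, 3, 4] ![1, 3, 5]
  have q2 := h ![1, 2, 3] ![1, 3, 4]
  have c2 := h ![0, 4, 5] ![2, 3, 4]
  have m1 := h ![0, 2, 3] ![2, 3, 4]
  have m2 := h ![0, 2, 3] ![2, 3, 5]
  have m3 := h ![2, 3, 4] ![2, 3, 4]
  have m4 := h ![0, 2, 4] ![0, 2, 4]
  have m5 := h ![0, 4, 5] ![0, 4, 5]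
  have m6 := h ![0, 2, 5] ![0, 2, 5]
  clear h
  simp only [ternaryCatalecticant, Matrix.of_apply, Matrix.cons_val, Matrix.cons_val_zero,
    Matrix.cons_val_one] at h015 h014 h013 c1 u1 u2 u3 u4 u5 p0 p1 p2 p3 p4 p5 p6 q1 q2 c2 m1 m2 m3 m4 m5 m6
  obtain rfl : z = 0 := by
    have h2 : z ^ 3 = 0 := by linear_combination -h015 / 8
    exact eq_zero_of_pow_eq_zero h2
  obtain rfl : t = 0 := by
    by_contra ht
    obtain rfl : p = 0 := by
      have : t * p ^ 2 = 0 := by linear_combination -h014 / 4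
      simpa [ht] using this
    obtain rfl : q = 0 := by
      have : t * q ^ 2 = 0 := by linear_combination -h013 / 36
      simpa [ht] using this
    obtain rfl : b = -w := by
      have : (b + w) ^ 3 = 0 := by linear_combination -c1 / 8
      linear_combination eq_zero_of_pow_eq_zero this
    have e1 : (2 * w + 3 * m) * c = t ^ 2 := by
      refine mul_left_cancel₀ ht ?_
      linear_combination u1
    have e2 : c ^ 2 = (3 * a - w) * t := by
      refine mul_left_cancel₀ ht ?_
      linear_combination u2
    have hc : c ≠ 0 := by
      rintro rfl
      have : t ^ 2 = 0 := by linear_combination -e1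
      exact ht (eq_zero_of_pow_eq_zero this)
    set s := 2 * a + 2 * w with hs
    have e3 : 2 * t * m * c = 4 * t ^ 3 + c ^ 2 * s := by
      linear_combination u3
    have e4 : s * t ^ 2 * c ^ 2 = 2 * t ^ 5 + 2 * m * c ^ 4 := by
      linear_combination c ^ 2 / 2 * u4 +
        (2 * t * ((2 * w + 3 * m) * c + t ^ 2) - s * c ^ 2) * e1
    have e5 : s * t ^ 2 = 2 * c * t * (t + 3 * c) - 4 * m * c ^ 2 := by
      linear_combination -u5
    have e6 : 3 * s * c * (t + 2 * c) = 2 * c ^ 3 - 20 * t ^ 3 := by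
      linear_combination -2 * c * e2 + 4 * t * e1 - 6 * e3
    have e7 : 3 * s * t ^ 2 * c ^ 2 = 2 * c ^ 3 * t ^ 2 + 6 * c ^ 4 * t + 4 * t ^ 5 := by
      linear_combination c ^ 2 * e5 + 2 * e4
    have e8 : s * c ^ 2 * (t ^ 3 - c ^ 3) = 2 * t ^ 6 + 4 * c ^ 3 * t ^ 3 := by
      linear_combination t * e4 + c ^ 3 * e3
    have e9 : 3 * c ^ 7 + c ^ 6 * t - 3 * c ^ 4 * t ^ 3 + 7 * c ^ 3 * t ^ 4 + t ^ 7 = 0 := by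
      refine mul_left_cancel₀ ht ?_
      linear_combination (t ^ 3 - c ^ 3) / 2 * e7 - 3 / 2 * t ^ 2 * e8
    have e10 : 6 * c ^ 5 + 4 * c ^ 4 * t + c ^ 3 * t ^ 2 + 14 * c * t ^ 4 + 2 * t ^ 5 = 0 := by
      refine mul_left_cancel₀ ht ?_
      linear_combination -(t + 2 * c) / 2 * e7 + t ^ 2 * c / 2 * e6
    have : t ^ 11 = 0 := by
      linear_combination
        (4895517 * t ^ 4 - 117992 * c * t ^ 3 + 5858 * c ^ 2 * t ^ 2 + 866872 * c ^ 3 * t +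
          1859496 * c ^ 4) / 4804659 * e9 +
        (-45429 * t ^ 6 + 376999 * c * t ^ 5 - 2641922 * c ^ 2 * t ^ 4 + 948423 * c ^ 3 * t ^ 3 + 89897 * c ^ 4 * t ^ 2 -
          123520 * c ^ 5 * t - 929748 * c ^ 6) / 4804659 * e10
    exact ht (eq_zero_of_pow_eq_zero this)
  obtain rfl : p = 0 := by
    by_contra hp
    obtain rfl : b = -3 * a := by
      have : p ^ 2 * (b + 3 * a) = 0 := by linear_combination -p0
      have := (mul_eq_zero.1 this).resolve_left (pow_ne_zero 2 hp)
      linear_combination this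
    have e1 : q + 6 * a = 2 * w := by
      refine mul_left_cancel₀ (pow_ne_zero 2 hp) ?_
      linear_combination p1
    obtain rfl : w = (q + 6 * a) / 2 := by linear_combination -e1 / 2
    obtain rfl : c = 8 * a := by
      refine mul_left_cancel₀ (pow_ne_zero 2 hp) ?_
      linear_combination p3
    have e2 : p ^ 2 = 3 * q * (q + 8 * a) := by
      refine mul_left_cancel₀ hp ?_
      linear_combination p2
    obtain rfl : m = -6 * a := by
      refine mul_left_cancel₀ (pow_ne_zero 2 hp) ?_
      linear_combination p5 / 2
    have hr : q + 8 * a ≠ 0 := by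
      intro hr
      simp [hr, hp] at e2
    have e3 : 3 * a * p = 4 * (q + 8 * a) * (q - a) := by
      have : (q + 8 * a) ^ 2 = p * (3 * p - 6 * a) := by
        refine mul_left_cancel₀ hp ?_
        linear_combination -p4
      linear_combination this / 2 + 3 / 2 * e2
    have e4 : 48 * a * p = p ^ 2 - 24 * a * (q + 8 * a) := by
      refine mul_left_cancel₀ hr ?_
      linear_combination p6
    obtain rfl : q = 40 / 61 * a := by
      have : (q + 8 * a) * (61 * q - 40 * a) = 0 := by
        linear_combination e4 - 16 * e3 + e2
      have := (mul_eq_zero.1 this).resolve_left hr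
      linear_combination this / 61
    have ha : a ^ 4 = 0 := by
      linear_combination (13845841 / 154763136) *
        ((3 * a * p + 4 * (40 / 61 * a + 8 * a) * (40 / 61 * a - a)) * e3 -
        9 * a ^ 2 * e2)
    have := eq_zero_of_pow_eq_zero ha
    simp [this] at hr
  obtain rfl : q = 0 := by
    have : q ^ 3 = 0 := by linear_combination -q1 / 9 - q2 / 27
    exact eq_zero_of_pow_eq_zero this
  obtain rfl : c = 0 := by
    have : c ^ 3 = 0 := by linear_combination -c2 / 3
    exact eq_zero_of_pow_eq_zero this
  obtain rfl : b = -w := by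
    have : (b + w) ^ 3 = 0 := by linear_combination -c1 / 8
    linear_combination eq_zero_of_pow_eq_zero this
  have e1 : 2 * w + 3 * m = 0 := by
    by_contra hv
    obtain rfl : m = 0 := by
      have : m * (2 * w + 3 * m) ^ 2 = 0 := by linear_combination -m1
      exact (mul_eq_zero.1 this).resolve_right (pow_ne_zero 2 hv)
    have e2 : 3 * a - w = 0 := by
      have : (3 * a - w) * (2 * w + 3 * 0) ^ 2 = 0 := by linear_combination -m2
      exact (mul_eq_zero.1 this).resolve_right (pow_ne_zero 2 hv)
    have e3 : 2 * a + 2 * w = 0 := by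
      have : (2 * a + 2 * w) * (2 * w + 3 * 0) ^ 2 = 0 := by linear_combination -m3
      exact (mul_eq_zero.1 this).resolve_right (pow_ne_zero 2 hv)
    exact hv (by linear_combination -e2 / 2 + 3 / 4 * e3)
  have e2 : 3 * a - w = 0 := by
    by_contra hv
    have e3 : 2 * a + 2 * w = 0 := by
      have : (3 * a - w) ^ 2 * (2 * a + 2 * w) = 0 := by linear_combination -m5
      exact (mul_eq_zero.1 this).resolve_left (pow_ne_zero 2 hv)
    have e4 : m = 0 := by
      have : (3 * a - w) ^ 2 * m = 0 := by linear_combination -m6 / 4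
      exact (mul_eq_zero.1 this).resolve_left (pow_ne_zero 2 hv)
    exact hv (by linear_combination 3 / 2 * e3 - 2 * e1 + 6 * e4)
  obtain rfl : w = 3 * a := by linear_combination -e2
  obtain rfl : m = -2 * a := by linear_combination e1 / 3
  obtain rfl : a = 0 := by
    have : a ^ 3 = 0 := by linear_combination -m4 / 480
    exact eq_zero_of_pow_eq_zero this
  simp

end TernaryQuartic

section Quartic

/-- The action of the matrix `A` on a tensor with four indices, as a derivation. -/
def tensorAction {V : Type} [Fintype V] (A : V × V → ℂ) (f : V → V → V → V → ℂ)
    (i j k l : V) : ℂ :=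
  ∑ p, (A (p, i) * f p j k l + A (p, j) * f i p k l + A (p, k) * f i j p l + A (p, l) * f i j k p)

/-- The number of occurrences of `x` among `i, j, k, l`. -/
def indexCount {V : Type} [DecidableEq V] (i j k l x : V) : ℕ :=
  (if i = x then 1 else 0) + (if j = x then 1 else 0) + (if k = x then 1 else 0) +
    if l = x then 1 else 0

/-- The divided coefficients of a ternary quartic with trivial stabilizer. -/
def ternaryCoeff (a b c : ℕ) : ℂ :=
  if (a = 0 ∧ b = 1 ∧ c = 3) ∨ (a = 0 ∧ b = 2 ∧ c = 2) ∨ (a = 2 ∧ b = 0 ∧ c = 2) ∨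
    (a = 3 ∧ b = 1 ∧ c = 0) then 1 else 0

/-- The tensor `f` restricts to the ternary quartic `ternaryCoeff` on the first three variables,
and each further variable `p` enters, up to higher variables, through its square times
the quadratic form `q`. -/
structure IsQuarticTower {n : ℕ} (f : Fin (n + 3) → Fin (n + 3) → Fin (n + 3) → Fin (n + 3) → ℂ)
    (q : Fin (n + 3) → Fin (n + 3) → ℂ) : Prop where
  swap_fst : ∀ i j k l, f i j k l = f j i k l
  swap_mid : ∀ i j k l, f i j k l = f i k j l
  swap_snd : ∀ i j k l, f i j k l = f i j l k
  ternary : ∀ i j k l : Fin 3, f (Fin.castLE (by omega) i) (Fin.castLE (by omega) j)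
    (Fin.castLE (by omega) k) (Fin.castLE (by omega) l) =
      ternaryCoeff (indexCount i j k l 0) (indexCount i j k l 1) (indexCount i j k l 2)
  top_one : ∀ i j k p : Fin (n + 3), 3 ≤ p.val → i < p → j < p → k < p → f i j k p = 0
  top_two : ∀ i j p : Fin (n + 3), 3 ≤ p.val → i < p → j < p → f i j p p = q i j
  top_three : ∀ i p : Fin (n + 3), 3 ≤ p.val → i < p → f i p p p = 0
  q_comm : ∀ i j, q i j = q j i
  q_zero_zero : q 0 0 = 0
  q_zero_one : q 0 1 = 1
  q_zero_two : q 0 2 = 0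
  q_one_one : q 1 1 = 0
  q_one_two : q 1 2 = 0
  q_two_two : q 2 2 = 1
  q_zero_high : ∀ p : Fin (n + 3), 3 ≤ p.val → q 0 p = 1

theorem sum_eq_sum_fin_three {n : ℕ} (h : Fin (n + 3) → ℂ) (h0 : ∀ p, 3 ≤ p.val → h p = 0) :
    ∑ p, h p = ∑ p : Fin 3, h (Fin.castLE (by omega) p) := by
  rw [Fin.sum_univ_succ, Fin.sum_univ_succ, Fin.sum_univ_succ, Finset.sum_eq_zero]
  · rw [Fin.sum_univ_three, add_zero, ← add_assoc]
    rfl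
  · intro p _
    apply h0
    simp

namespace IsQuarticTower

variable {n : ℕ} {f : Fin (n + 3) → Fin (n + 3) → Fin (n + 3) → Fin (n + 3) → ℂ}
  {q : Fin (n + 3) → Fin (n + 3) → ℂ}

theorem top_one_mid (hf : IsQuarticTower f q) (i j k p : Fin (n + 3)) (hp : 3 ≤ p.val)
    (hi : i < p) (hj : j < p) (hk : k < p) : f i j p k = 0 := by
  rw [hf.swap_snd]
  exact hf.top_one i j k p hp hi hj hk

theorem top_one_snd (hf : IsQuarticTower f q) (i j k p : Fin (n + 3)) (hp : 3 ≤ p.val)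
    (hi : i < p) (hj : j < p) (hk : k < p) : f i p j k = 0 := by
  rw [hf.swap_mid]
  exact hf.top_one_mid i j k p hp hi hj hk

theorem top_one_fst (hf : IsQuarticTower f q) (i j k p : Fin (n + 3)) (hp : 3 ≤ p.val)
    (hi : i < p) (hj : j < p) (hk : k < p) : f p i j k = 0 := by
  rw [hf.swap_fst]
  exact hf.top_one_snd i j k p hp hi hj hk

theorem action_swap_fst (hf : IsQuarticTower f q) (A : Fin (n + 3) × Fin (n + 3) → ℂ)
    (i j k l : Fin (n + 3)) : tensorAction A f i j k l = tensorAction A f j i k l := by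
  refine Finset.sum_congr rfl fun p _ => ?_
  rw [hf.swap_fst p j, hf.swap_fst i p, hf.swap_fst i j, hf.swap_fst i j]
  ring

theorem action_swap_mid (hf : IsQuarticTower f q) (A : Fin (n + 3) × Fin (n + 3) → ℂ)
    (i j k l : Fin (n + 3)) : tensorAction A f i j k l = tensorAction A f i k j l := by
  refine Finset.sum_congr rfl fun p _ => ?_
  rw [hf.swap_mid p j, hf.swap_mid i p, hf.swap_mid i j p, hf.swap_mid i j k]
  ring

theorem action_swap_snd (hf : IsQuarticTower f q) (A : Fin (n + 3) × Fin (n + 3) → ℂ)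
    (i j k l : Fin (n + 3)) : tensorAction A f i j k l = tensorAction A f i j l k := by
  refine Finset.sum_congr rfl fun p _ => ?_
  rw [hf.swap_snd p j, hf.swap_snd i p, hf.swap_snd i j p, hf.swap_snd i j k]
  ring

/-- The base of the induction: the action on the first three variables. -/
theorem action_ternary_eq_zero (hf : IsQuarticTower f q) (A : Fin (n + 3) × Fin (n + 3) → ℂ)
    (hA : ∀ r c : Fin 3 → Fin (n + 3) × Fin (n + 3), (Matrix.of fun s t =>
      tensorAction A f (r s).1 (r s).2 (c t).1 (c t).2).det = 0) (i j : Fin (n + 3))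
    (hi : i.val < 3) (hj : j.val < 3) : A (i, j) = 0 := by
  set e : Fin 3 → Fin (n + 3) := Fin.castLE (by omega) with he
  have hlt : ∀ x (p : Fin (n + 3)), 3 ≤ p.val → e x < p := by
    intro x p hp
    rw [Fin.lt_def]
    exact lt_of_lt_of_le x.2 hp
  set K : Fin 3 → Fin 3 → Fin 3 → Fin 3 → ℂ := fun i j k l =>
    ternaryCoeff (indexCount i j k l 0) (indexCount i j k l 1) (indexCount i j k l 2) with hK
  have hg : ∀ i j k l : Fin 3, tensorAction A f (e i) (e j) (e k) (e l) =
      ∑ p, (A (e p, e i) * K p j k l + A (e p, e j) * K i p k l + A (e p, e k) * K i j p l +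
        A (e p, e l) * K i j k p) := by
    intro i j k l
    rw [tensorAction, sum_eq_sum_fin_three]
    · refine Finset.sum_congr rfl fun p _ => ?_
      simp only [hK, ← hf.ternary, he]
    · intro p hp
      rw [hf.top_one_fst _ _ _ p hp (hlt _ _ hp) (hlt _ _ hp) (hlt _ _ hp),
        hf.top_one_snd _ _ _ p hp (hlt _ _ hp) (hlt _ _ hp) (hlt _ _ hp),
        hf.top_one_mid _ _ _ p hp (hlt _ _ hp) (hlt _ _ hp) (hlt _ _ hp),
        hf.top_one _ _ _ p hp (hlt _ _ hp) (hlt _ _ hp) (hlt _ _ hp)]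
      ring
  let P : Fin 6 → Fin 3 × Fin 3 := ![(0, 0), (1, 1), (2, 2), (1, 2), (0, 2), (0, 1)]
  have hmat : ∀ u v : Fin 6, tensorAction A f (e (P u).1) (e (P u).2) (e (P v).1) (e (P v).2) =
      ternaryCatalecticant (A (e 0, e 0)) (A (e 0, e 1)) (A (e 0, e 2)) (A (e 1, e 0))
        (A (e 1, e 1)) (A (e 1, e 2)) (A (e 2, e 0)) (A (e 2, e 1)) (A (e 2, e 2)) u v := by
    intro u v
    rw [hg]
    fin_cases u <;> fin_cases v <;>
      simp [P, hK, ternaryCatalecticant, ternaryCoeff, indexCount, Fin.sum_univ_three] <;> ring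
  obtain ⟨h1, h2, h3, h4, h5, h6, h7, h8, h9⟩ := eq_zero_of_ternaryCatalecticant_minors
    (A (e 0, e 0)) (A (e 0, e 1)) (A (e 0, e 2)) (A (e 1, e 0))
    (A (e 1, e 1)) (A (e 1, e 2)) (A (e 2, e 0)) (A (e 2, e 1)) (A (e 2, e 2)) (by
      intro r s
      rw [← hA (fun x => (e (P (r x)).1, e (P (r x)).2)) (fun x => (e (P (s x)).1, e (P (s x)).2))]
      congr 1
      ext x y
      simp only [Matrix.submatrix_apply, Matrix.of_apply, hmat])
  have hall : ∀ x y : Fin 3, A (e x, e y) = 0 := by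
    intro x y
    fin_cases x <;> fin_cases y <;> assumption
  exact hall ⟨i, hi⟩ ⟨j, hj⟩

/-- If the coefficients linear in `Y` of the image of `f` under the entries `a p = A (p, Y)` and
`b p = A (Y, p)` form a tensor of rank at most one, then these entries vanish. -/
theorem coeff_eq_zero_of_rank_one (hf : IsQuarticTower f q) (a b : Fin (n + 3) → ℂ)
    (Y : Fin (n + 3)) (hY : 3 ≤ Y.val)
    (C : Fin (n + 3) → Fin (n + 3) → Fin (n + 3) → ℂ)
    (hC : ∀ i j l, i < Y → j < Y → l < Y →
      C i j l = ∑ p, a p * f i j l p + b i * q j l + b j * q i l + b l * q i j)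
    (hr : ∀ i j l i' j' l', i < Y → j < Y → l < Y → i' < Y → j' < Y → l' < Y →
      C i j l * C i' j' l' = C i j l' * C i' j' l) (p : Fin (n + 3)) (hp : p < Y) :
    a p = 0 ∧ b p = 0 := by
  have h0Y : (0 : Fin (n + 3)) < Y := (show (0 : ℕ) < Y by omega)
  have h1Y : (1 : Fin (n + 3)) < Y := (show (1 : ℕ) < Y by omega)
  have h2Y : (2 : Fin (n + 3)) < Y := (show (2 : ℕ) < Y by omega)
  suffices h : ∀ m, 3 ≤ m → ∀ p : Fin (n + 3), p.val < m → p < Y → a p = 0 ∧ b p = 0 from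
    h Y.val hY p hp hp
  clear! p
  intro m hm
  induction m, hm using Nat.le_induction with
  | base =>
    set e : Fin 3 → Fin (n + 3) := Fin.castLE (by omega) with he
    have heY : ∀ x, e x < Y := fun x => by
      rw [Fin.lt_def]
      exact lt_of_lt_of_le x.2 hY
    have hlt : ∀ x (p : Fin (n + 3)), 3 ≤ p.val → e x < p := by
      intro x p hp
      rw [Fin.lt_def]
      exact lt_of_lt_of_le x.2 hp
    have hval : ∀ i j l : Fin 3, C (e i) (e j) (e l) =
        ∑ p, a (e p) * ternaryCoeff (indexCount i j l p 0) (indexCount i j l p 1)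
          (indexCount i j l p 2) + b (e i) * q (e j) (e l) + b (e j) * q (e i) (e l) +
            b (e l) * q (e i) (e j) := by
      intro i j l
      rw [hC _ _ _ (heY i) (heY j) (heY l), sum_eq_sum_fin_three]
      · simp only [← hf.ternary, he]
      · intro p hp
        rw [hf.top_one _ _ _ p hp (hlt _ _ hp) (hlt _ _ hp) (hlt _ _ hp), mul_zero]
    have e0 : e 0 = 0 := rfl
    have e1 : e 1 = 1 := rfl
    have e2 : e 2 = 2 := rfl
    have v111 := hval 1 1 1
    have v112 := hval 1 1 2
    have v121 := hval 1 2 1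
    have v122 := hval 1 2 2
    have v221 := hval 2 2 1
    have v011 := hval 0 1 1
    have v110 := hval 1 1 0
    have v010 := hval 0 1 0
    have v001 := hval 0 0 1
    have v012 := hval 0 1 2
    have v021 := hval 0 2 1
    have v022 := hval 0 2 2
    have v220 := hval 2 2 0
    have v020 := hval 0 2 0
    simp [Fin.sum_univ_three, ternaryCoeff, indexCount, e0, e1, e2, hf.q_zero_zero, hf.q_zero_one,
      hf.q_zero_two, hf.q_one_one, hf.q_one_two, hf.q_two_two, hf.q_comm 1 0, hf.q_comm 2 0,
      hf.q_comm 2 1] at v111 v112 v121 v122 v221 v011 v110 v010 v001 v012 v021 v022 v220 v020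
    have a2 : a 2 = 0 := by
      have h := hr 1 1 2 1 2 1 h1Y h1Y h2Y h1Y h2Y h1Y
      rw [v112, v121, v111] at h
      have h' : (a 2) ^ 2 = 0 := by linear_combination h
      exact eq_zero_of_pow_eq_zero h'
    have b1 : b 1 = 0 := by
      have h := hr 0 1 1 1 1 0 h0Y h1Y h1Y h1Y h1Y h0Y
      rw [v011, v110, v111] at h
      have h' : (b 1) ^ 2 = 0 := by linear_combination h / 4
      exact eq_zero_of_pow_eq_zero h'
    have b2 : b 2 = 0 := by
      have h := hr 0 1 2 0 2 1 h0Y h1Y h2Y h0Y h2Y h1Y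
      rw [v012, v021, v011, v022] at h
      have h' : (b 2) ^ 2 = 0 := by linear_combination h + 2 * (a 0 + b 0) * b1
      exact eq_zero_of_pow_eq_zero h'
    have ab : a 0 + b 0 + b 0 = 0 := by
      have h := hr 0 0 1 0 1 0 h0Y h0Y h1Y h0Y h1Y h0Y
      rw [v001, v010, v011] at h
      have h' : (a 0 + b 0 + b 0) ^ 2 = 0 := by linear_combination h + 2 * C 0 0 0 * b1
      exact eq_zero_of_pow_eq_zero h'
    have a1 : a 1 + a 2 + b 1 = 0 := by
      have h := hr 1 2 2 2 2 1 h1Y h2Y h2Y h2Y h2Y h1Y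
      rw [v122, v221, v121] at h
      have h' : (a 1 + a 2 + b 1) ^ 2 = 0 := by linear_combination h + C 2 2 2 * a2
      exact eq_zero_of_pow_eq_zero h'
    have ab' : a 0 + b 0 = 0 := by
      have h := hr 0 2 2 2 2 0 h0Y h2Y h2Y h2Y h2Y h0Y
      rw [v022, v220, v020] at h
      have h' : (a 0 + b 0) ^ 2 = 0 := by linear_combination h + C 2 2 2 * a2
      exact eq_zero_of_pow_eq_zero h'
    intro p hp _
    obtain h | h | h : p.val = 0 ∨ p.val = 1 ∨ p.val = 2 := by omega
    · obtain rfl : p = 0 := Fin.ext h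
      exact ⟨by linear_combination 2 * ab' - ab, by linear_combination ab - ab'⟩
    · obtain rfl : p = 1 := Fin.ext h
      exact ⟨by linear_combination a1 - a2 - b1, b1⟩
    · obtain rfl : p = 2 := Fin.ext h
      exact ⟨a2, b2⟩
  | succ m hm ih =>
    intro p hpm hpY
    rcases Nat.lt_succ_iff_lt_or_eq.1 hpm with h | h
    · exact ih p h hpY
    have hp3 : 3 ≤ p.val := by omega
    have ih' : ∀ x, x < p → a x = 0 ∧ b x = 0 := fun x hx =>
      ih x (by rw [Fin.lt_def] at hx; omega) (hx.trans hpY)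
    have h0p : (0 : Fin (n + 3)) < p := (show (0 : ℕ) < p by omega)
    have h1p : (1 : Fin (n + 3)) < p := (show (1 : ℕ) < p by omega)
    have hsum : ∀ i j l, i ≤ p → j ≤ p → l ≤ p →
        ∑ x, a x * f i j l x = a p * f i j l p := by
      intro i j l hi hj hl
      refine Finset.sum_eq_single p (fun x _ hx => ?_) (by simp)
      rcases lt_or_gt_of_ne hx with h | h
      · rw [(ih' x h).1, zero_mul]
      · rw [hf.top_one i j l x (hp3.trans h.le) (hi.trans_lt h) (hj.trans_lt h) (hl.trans_lt h),
          mul_zero]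
    have hlow : ∀ i j, i < p → j < p → C i j p = (a p + b p) * q i j := by
      intro i j hi hj
      rw [hC i j p (hi.trans hpY) (hj.trans hpY) hpY, hsum i j p hi.le hj.le le_rfl,
        hf.top_two i j p hp3 hi hj, (ih' i hi).2, (ih' j hj).2]
      ring
    have hab : a p + b p = 0 := by
      have h1 := hr 0 1 p 0 p 1 h0Y h1Y hpY h0Y hpY h1Y
      have h2 : C 0 p 1 = a p + b p := by
        rw [hC 0 p 1 h0Y hpY h1Y, hsum 0 p 1 h0p.le le_rfl h1p.le, hf.swap_mid,
          hf.top_two 0 1 p hp3 h0p h1p, (ih' 0 h0p).2, (ih' 1 h1p).2, hf.q_zero_one]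
        ring
      have h3 : C 0 1 1 = 0 := by
        rw [hC 0 1 1 h0Y h1Y h1Y, hsum 0 1 1 h0p.le h1p.le h1p.le,
          hf.top_one 0 1 1 p hp3 h0p h1p h1p, (ih' 0 h0p).2, (ih' 1 h1p).2]
        ring
      rw [hlow 0 1 h0p h1p, h2, h3, hf.q_zero_one] at h1
      have : (a p + b p) ^ 2 = 0 := by linear_combination h1
      exact eq_zero_of_pow_eq_zero this
    have hb : b p = 0 := by
      have h1 := hr 0 p p p p 0 h0Y hpY hpY hpY hpY h0Y
      have h2 : C 0 p p = 2 * b p := by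
        rw [hC 0 p p h0Y hpY hpY, hsum 0 p p h0p.le le_rfl le_rfl,
          hf.top_three 0 p hp3 h0p, (ih' 0 h0p).2, hf.q_zero_high p hp3]
        ring
      have h3 : C p p 0 = 2 * b p := by
        rw [hC p p 0 hpY hpY h0Y, hsum p p 0 le_rfl le_rfl h0p.le, hf.swap_mid, hf.swap_fst,
          hf.top_three 0 p hp3 h0p, (ih' 0 h0p).2, hf.q_comm p 0, hf.q_zero_high p hp3]
        ring
      have h4 : C 0 p 0 = 0 := by
        rw [hC 0 p 0 h0Y hpY h0Y, hsum 0 p 0 h0p.le le_rfl h0p.le, hf.swap_mid,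
          hf.top_two 0 0 p hp3 h0p h0p, (ih' 0 h0p).2, hf.q_zero_zero]
        ring
      rw [h2, h3, h4] at h1
      have : (b p) ^ 2 = 0 := by linear_combination h1 / 4
      exact eq_zero_of_pow_eq_zero this
    exact ⟨by linear_combination hab - hb, hb⟩

theorem action_step (hf : IsQuarticTower f q) (A : Fin (n + 3) × Fin (n + 3) → ℂ)
    (hA : ∀ r c : Fin 3 → Fin (n + 3) × Fin (n + 3), (Matrix.of fun s t =>
      tensorAction A f (r s).1 (r s).2 (c t).1 (c t).2).det = 0) (Y : Fin (n + 3))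
    (hY : 3 ≤ Y.val) (ih : ∀ i j, i < Y → j < Y → A (i, j) = 0) (i j : Fin (n + 3))
    (hi : i ≤ Y) (hj : j ≤ Y) : A (i, j) = 0 := by
  have h0Y : (0 : Fin (n + 3)) < Y := (show (0 : ℕ) < Y by omega)
  have h1Y : (1 : Fin (n + 3)) < Y := (show (1 : ℕ) < Y by omega)
  have hlow : ∀ i j k l, i < Y → j < Y → k < Y → l < Y → tensorAction A f i j k l = 0 := by
    intro i j k l hi hj hk hl
    refine Finset.sum_eq_zero fun p _ => ?_
    rcases lt_or_ge p Y with hp | hp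
    · rw [ih p i hp hi, ih p j hp hj, ih p k hp hk, ih p l hp hl]
      ring
    · have hp3 : 3 ≤ p.val := hY.trans hp
      have hi := hi.trans_le hp
      have hj := hj.trans_le hp
      have hk := hk.trans_le hp
      have hl := hl.trans_le hp
      rw [hf.top_one_fst j k l p hp3 hj hk hl, hf.top_one_snd i k l p hp3 hi hk hl,
        hf.top_one_mid i j l p hp3 hi hj hl, hf.top_one i j k p hp3 hi hj hk]
      ring
  have hC : ∀ i j l, i < Y → j < Y → l < Y → tensorAction A f i j l Y =
      ∑ p, A (p, Y) * f i j l p + A (Y, i) * q j l + A (Y, j) * q i l + A (Y, l) * q i j := by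
    intro i j l hi hj hl
    have hterm : ∀ u v w, u < Y → v < Y → w < Y →
        ∑ p, A (p, u) * f v w Y p = A (Y, u) * q v w := by
      intro u v w hu hv hw
      rw [Finset.sum_eq_single Y (fun p _ hp => ?_) (by simp), hf.top_two v w Y hY hv hw]
      rcases lt_or_gt_of_ne hp with h | h
      · rw [ih p u h hu, zero_mul]
      · rw [hf.top_one v w Y p (hY.trans h.le) (hv.trans h) (hw.trans h) h, mul_zero]
    rw [← hterm i j l hi hj hl, ← hterm j i l hj hi hl, ← hterm l i j hl hi hj,
      ← Finset.sum_add_distrib, ← Finset.sum_add_distrib, ← Finset.sum_add_distrib]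
    refine Finset.sum_congr rfl fun p _ => ?_
    rw [hf.swap_fst p j, hf.swap_mid j p, hf.swap_snd j l p, hf.swap_mid i p, hf.swap_snd i l p,
      hf.swap_snd i j p]
    ring
  have hr : ∀ i j l i' j' l', i < Y → j < Y → l < Y → i' < Y → j' < Y → l' < Y →
      tensorAction A f i j l Y * tensorAction A f i' j' l' Y =
        tensorAction A f i j l' Y * tensorAction A f i' j' l Y := by
    intro i j l i' j' l' hi hj hl hi' hj' hl'
    by_contra hne
    have hall : ∀ u s t, u < Y → s < Y → t < Y → tensorAction A f u s t Y = 0 := by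
      intro u s t hu hs ht
      have h := hA ![(i, j), (i', j'), (u, Y)] ![(l, Y), (l', Y), (s, t)]
      simp only [Matrix.det_fin_three, Matrix.of_apply, Matrix.cons_val_zero, Matrix.cons_val_one,
        Matrix.cons_val] at h
      rw [hlow i j s t hi hj hs ht, hlow i' j' s t hi' hj' hs ht, hf.action_swap_mid A u Y s t,
        hf.action_swap_snd A u s Y t] at h
      have h' : (tensorAction A f i j l Y * tensorAction A f i' j' l' Y -
          tensorAction A f i j l' Y * tensorAction A f i' j' l Y) * tensorAction A f u s t Y = 0 := by
        linear_combination h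
      exact (mul_eq_zero.1 h').resolve_left (sub_ne_zero.2 hne)
    exact hne (by rw [hall i j l hi hj hl, hall i j l' hi hj hl']; ring)
  have hab := hf.coeff_eq_zero_of_rank_one (fun p => A (p, Y)) (fun p => A (Y, p)) Y hY
    (fun i j l => tensorAction A f i j l Y) hC hr
  have hzero : ∀ i j l, i < Y → j < Y → l < Y → tensorAction A f i j l Y = 0 := by
    intro i j l hi hj hl
    rw [hC i j l hi hj hl, (hab i hi).2, (hab j hj).2, (hab l hl).2, Finset.sum_eq_zero]
    · ring
    · intro p _
      rcases lt_trichotomy p Y with h | rfl | h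
      · rw [(hab p h).1, zero_mul]
      · rw [hf.top_one i j l p hY hi hj hl, mul_zero]
      · rw [hf.top_one i j l p (hY.trans h.le) (hi.trans h) (hj.trans h) (hl.trans h), mul_zero]
  have hsq : ∀ i j, i < Y → j < Y → tensorAction A f i j Y Y = 2 * A (Y, Y) * q i j := by
    intro i j hi hj
    rw [tensorAction, Finset.sum_eq_single Y (fun p _ hp => ?_) (by simp)]
    · rw [(hab i hi).2, (hab j hj).2, hf.top_two i j Y hY hi hj]
      ring
    · rcases lt_or_gt_of_ne hp with h | h
      · rw [ih p i h hi, ih p j h hj, (hab p h).1]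
        ring
      · have hp3 : 3 ≤ p.val := hY.trans h.le
        have hi := hi.trans h
        have hj := hj.trans h
        rw [hf.top_one_fst j Y Y p hp3 hj h h, hf.top_one_snd i Y Y p hp3 hi h h,
          hf.top_one_mid i j Y p hp3 hi hj h, hf.top_one i j Y p hp3 hi hj h]
        ring
  have he : A (Y, Y) = 0 := by
    have h := hA ![(0, 1), (0, Y), (Y, Y)] ![(0, 1), (1, Y), (Y, Y)]
    simp only [Matrix.det_fin_three, Matrix.of_apply, Matrix.cons_val_zero, Matrix.cons_val_one,
      Matrix.cons_val] at h
    have e1 : tensorAction A f 0 Y 0 1 = 0 := by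
      rw [hf.action_swap_mid, hf.action_swap_snd, hzero 0 0 1 h0Y h0Y h1Y]
    have e2 : tensorAction A f 0 Y 1 Y = 2 * A (Y, Y) := by
      rw [hf.action_swap_mid, hsq 0 1 h0Y h1Y, hf.q_zero_one, mul_one]
    have e3 : tensorAction A f Y Y 0 1 = 2 * A (Y, Y) := by
      rw [hf.action_swap_mid, hf.action_swap_fst, hf.action_swap_snd, hf.action_swap_mid,
        hsq 0 1 h0Y h1Y, hf.q_zero_one, mul_one]
    rw [hlow 0 1 0 1 h0Y h1Y h0Y h1Y, hzero 0 1 1 h0Y h1Y h1Y, hsq 0 1 h0Y h1Y, hf.q_zero_one,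
      e1, e2, e3] at h
    have h' : A (Y, Y) ^ 3 = 0 := by linear_combination -h / 8
    exact eq_zero_of_pow_eq_zero h'
  rcases hi.lt_or_eq with hi | rfl
  · rcases hj.lt_or_eq with hj | rfl
    · exact ih i j hi hj
    · exact (hab i hi).1
  · rcases hj.lt_or_eq with hj | rfl
    · exact (hab j hj).2
    · exact he

theorem eq_zero_of_action_rank_le (hf : IsQuarticTower f q) (A : Fin (n + 3) × Fin (n + 3) → ℂ)
    (hA : ∀ r c : Fin 3 → Fin (n + 3) × Fin (n + 3), (Matrix.of fun s t =>
      tensorAction A f (r s).1 (r s).2 (c t).1 (c t).2).det = 0) : A = 0 := by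
  have h : ∀ m, 3 ≤ m → ∀ i j : Fin (n + 3), i.val < m → j.val < m → A (i, j) = 0 := by
    intro m hm
    induction m, hm using Nat.le_induction with
    | base => exact hf.action_ternary_eq_zero A hA
    | succ m hm ih =>
      intro i j hi hj
      by_cases hmn : m < n + 3
      · exact hf.action_step A hA ⟨m, hmn⟩ hm (fun i j => ih i j) i j (Nat.lt_succ_iff.1 hi)
          (Nat.lt_succ_iff.1 hj)
      · exact ih i j (by omega) (by omega)
  ext ⟨i, j⟩
  exact h (n + 3) (by omega) i j i.2 j.2

end IsQuarticTower

end Quartic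

section QuarticExample

/-- The exponent of the monomial `X_i * X_j * X_k * X_l`. -/
def quarticExponent {V : Type} (i j k l : V) : V →₀ ℕ :=
  Finsupp.single i 1 + Finsupp.single j 1 + Finsupp.single k 1 + Finsupp.single l 1

theorem quarticExponent_apply {V : Type} [DecidableEq V] (i j k l x : V) :
    quarticExponent i j k l x = indexCount i j k l x := by
  simp [quarticExponent, indexCount, Finsupp.single_apply]

theorem shiftSum_quarticExponent {V : Type} [Fintype V] (A : V × V → ℂ) (F : (V →₀ ℕ) → ℂ)
    (i j k l : V) : shiftSum A F (quarticExponent i j k l) =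
      tensorAction A (fun i j k l => F (quarticExponent i j k l)) i j k l := by
  classical
  refine Finset.sum_congr rfl fun p _ => ?_
  set m := quarticExponent i j k l with hm
  have h1 : ∀ x, A (p, x) * ((m x : ℂ) * F (m - Finsupp.single x 1 + Finsupp.single p 1)) =
      (if i = x then A (p, x) * F (m - Finsupp.single x 1 + Finsupp.single p 1) else 0) +
      (if j = x then A (p, x) * F (m - Finsupp.single x 1 + Finsupp.single p 1) else 0) +
      (if k = x then A (p, x) * F (m - Finsupp.single x 1 + Finsupp.single p 1) else 0) +
      (if l = x then A (p, x) * F (m - Finsupp.single x 1 + Finsupp.single p 1) else 0) := by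
    intro x
    rw [hm, quarticExponent_apply, indexCount]
    push_cast
    simp only [add_mul, mul_add, ite_mul, one_mul, zero_mul, mul_ite, mul_zero]
  have hi : m - Finsupp.single i 1 + Finsupp.single p 1 = quarticExponent p j k l := by
    ext x
    simp [hm, quarticExponent]
    omega
  have hj : m - Finsupp.single j 1 + Finsupp.single p 1 = quarticExponent i p k l := by
    ext x
    simp [hm, quarticExponent]
    omega
  have hk : m - Finsupp.single k 1 + Finsupp.single p 1 = quarticExponent i j p l := by
    ext x
    simp [hm, quarticExponent]
    omega
  have hl : m - Finsupp.single l 1 + Finsupp.single p 1 = quarticExponent i j k p := by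
    ext x
    simp [hm, quarticExponent]
  rw [Finset.sum_congr rfl fun x _ => h1 x]
  simp only [Finset.sum_add_distrib, Finset.sum_ite_eq, Finset.mem_univ, if_true, hi, hj, hk, hl]

/-- The divided coefficients of the quadratic form attached to each variable after the third. -/
def towerQuadric (a b c : ℕ) : ℂ :=
  if (a = 1 ∧ b = 1 ∧ c = 0) ∨ (a = 0 ∧ b = 0 ∧ c = 2) ∨ (a = 1 ∧ b = 0 ∧ c = 0) then 1 else 0

open Classical in
/-- The divided coefficients of a quartic in `n + 3` variables with trivial stabilizer. -/
def towerQuartic (n : ℕ) (m : Fin (n + 3) →₀ ℕ) : ℂ :=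
  if ∃ p : Fin (n + 3), 3 ≤ p.val ∧ m p = 2 ∧ ∀ p', p < p' → m p' = 0 then
    towerQuadric (m 0) (m 1) (m 2)
  else if ∀ p : Fin (n + 3), 3 ≤ p.val → m p = 0 then ternaryCoeff (m 0) (m 1) (m 2) else 0

theorem fin_zero_ne_two (n : ℕ) : (0 : Fin (n + 3)) ≠ 2 := fun h =>
  absurd (congrArg Fin.val h) (show (0 : ℕ) ≠ 2 by omega)

theorem fin_one_ne_two (n : ℕ) : (1 : Fin (n + 3)) ≠ 2 := fun h =>
  absurd (congrArg Fin.val h) (show (1 : ℕ) ≠ 2 by omega)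

theorem isQuarticTower_towerQuartic (n : ℕ) :
    IsQuarticTower (fun i j k l => towerQuartic n (quarticExponent i j k l))
      (fun i j => towerQuadric ((Finsupp.single i 1 + Finsupp.single j 1 : Fin (n + 3) →₀ ℕ) 0)
        ((Finsupp.single i 1 + Finsupp.single j 1 : Fin (n + 3) →₀ ℕ) 1)
        ((Finsupp.single i 1 + Finsupp.single j 1 : Fin (n + 3) →₀ ℕ) 2)) where
  swap_fst i j k l := by
    congr 1
    simp only [quarticExponent]
    abel
  swap_mid i j k l := by
    congr 1
    simp only [quarticExponent]
    abel
  swap_snd i j k l := by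
    congr 1
    simp only [quarticExponent]
    abel
  ternary i j k l := by
    have h : ∀ p : Fin (n + 3), 3 ≤ p.val → indexCount (Fin.castLE (by omega) i : Fin (n + 3))
        (Fin.castLE (by omega) j) (Fin.castLE (by omega) k) (Fin.castLE (by omega) l) p = 0 := by
      intro p hp
      have hne : ∀ x : Fin 3, (Fin.castLE (by omega) x : Fin (n + 3)) ≠ p := by
        intro x hx
        have h1 : x.val = p.val := congrArg Fin.val hx
        have h2 := x.2
        omega
      simp [indexCount, hne]
    have h' : ∀ x : Fin 3, indexCount (Fin.castLE (by omega) i : Fin (n + 3))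
        (Fin.castLE (by omega) j) (Fin.castLE (by omega) k) (Fin.castLE (by omega) l)
        (Fin.castLE (by omega) x) = indexCount i j k l x := by
      intro x
      simp [indexCount]
    simp only [towerQuartic, quarticExponent_apply]
    rw [if_neg, if_pos h]
    · rw [← h' 0, ← h' 1, ← h' 2]
      rfl
    · rintro ⟨p, hp, h2, -⟩
      rw [h p hp] at h2
      omega
  top_one i j k p hp hi hj hk := by
    have h1 : indexCount i j k p p = 1 := by
      simp [indexCount, hi.ne, hj.ne, hk.ne]
    simp only [towerQuartic, quarticExponent_apply]
    rw [if_neg, if_neg]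
    · intro h
      rw [h p hp] at h1
      omega
    · rintro ⟨x, hx, h2, h3⟩
      rcases lt_trichotomy x p with h | rfl | h
      · rw [h3 p h] at h1
        omega
      · omega
      · simp [indexCount, (hi.trans h).ne, (hj.trans h).ne, (hk.trans h).ne, h.ne] at h2
  top_two i j p hp hi hj := by
    have hne : ∀ x : Fin (n + 3), x.val < 3 → p ≠ x := by
      rintro x hx rfl
      omega
    have h0 := hne 0 (show 0 < 3 by omega)
    have h1 := hne 1 (show 1 < 3 by omega)
    have h2 := hne 2 (show 2 < 3 by omega)
    simp only [towerQuartic, quarticExponent_apply]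
    rw [if_pos]
    · simp [indexCount, Finsupp.single_apply, h0, h1, h2]
    · refine ⟨p, hp, ?_, fun x hx => ?_⟩
      · simp [indexCount, hi.ne, hj.ne]
      · simp [indexCount, (hi.trans hx).ne, (hj.trans hx).ne, hx.ne]
  top_three i p hp hi := by
    have h1 : indexCount i p p p p = 3 := by
      simp [indexCount, hi.ne]
    simp only [towerQuartic, quarticExponent_apply]
    rw [if_neg, if_neg]
    · intro h
      rw [h p hp] at h1
      omega
    · rintro ⟨x, hx, h2, h3⟩
      rcases lt_trichotomy x p with h | rfl | h
      · rw [h3 p h] at h1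
        omega
      · omega
      · simp [indexCount, (hi.trans h).ne, h.ne] at h2
  q_comm i j := by rw [add_comm (Finsupp.single i 1)]
  q_zero_zero := by simp [towerQuadric, Finsupp.single_apply]
  q_zero_one := by simp [towerQuadric, (fin_zero_ne_two n), (fin_one_ne_two n)]
  q_zero_two := by simp [towerQuadric, Finsupp.single_apply]
  q_one_one := by simp [towerQuadric, Finsupp.single_apply]
  q_one_two := by simp [towerQuadric, Finsupp.single_apply]
  q_two_two := by
    simp [towerQuadric, (fin_zero_ne_two n).symm, (fin_one_ne_two n).symm]
  q_zero_high p hp := by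
    have hne : ∀ x : Fin (n + 3), x.val < 3 → p ≠ x := by
      rintro x hx rfl
      omega
    have h0 := hne 0 (show 0 < 3 by omega)
    have h1 := hne 1 (show 1 < 3 by omega)
    have h2 := hne 2 (show 2 < 3 by omega)
    simp [towerQuadric, h0, h1, h2, (fin_zero_ne_two n)]

theorem eq_zero_of_catalecticantRankLE_towerQuartic {n : ℕ} (A : Fin (n + 3) × Fin (n + 3) → ℂ)
    (hA : CatalecticantRankLE 4 (shiftSum A (towerQuartic n))) : A = 0 := by
  refine (isQuarticTower_towerQuartic n).eq_zero_of_action_rank_le A fun r c => ?_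
  rw [← hA (fun s => Finsupp.single (r s).1 1 + Finsupp.single (r s).2 1)
    (fun t => Finsupp.single (c t).1 1 + Finsupp.single (c t).2 1) (by simp [map_add])
    (by simp [map_add])]
  congr 1
  ext s t
  simp only [Matrix.of_apply]
  rw [← shiftSum_quarticExponent]
  congr 1
  simp only [quarticExponent]
  abel

end QuarticExample

section LinearForms

variable {V : Type} [Fintype V]

theorem eq_sum_of_isHomogeneous_one {x : MvPolynomial V ℂ} (hx : x.IsHomogeneous 1) :
    x = ∑ i, C (coeff (Finsupp.single i 1) x) * X i := by
  classical
  ext m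
  simp only [coeff_sum, coeff_C_mul, coeff_X]
  by_cases hm : m.degree = 1
  · obtain ⟨i, m', rfl⟩ := exists_single_le_of_degree_pos (m := m) (by omega)
    obtain rfl : m' = 0 := by
      rw [← Finsupp.degree_eq_zero_iff]
      rw [map_add, Finsupp.degree_single] at hm
      omega
    simp [Finsupp.single_left_inj]
  · rw [not_not.1 (mt (degree_eq_of_coeff_ne_zero hx) hm), Finset.sum_eq_zero]
    intro i _
    rw [if_neg, mul_zero]
    rintro rfl
    simp at hm

theorem exists_linDer_eq_of_mem_span {d : ℕ} (hd : 1 ≤ d) {f g : MvPolynomial V ℂ}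
    (hf : f.IsHomogeneous d) (hg : g.IsHomogeneous d)
    (h : g ∈ Ideal.span (Set.range fun i => pderiv i f)) : ∃ A : V × V → ℂ, linDer A f = g := by
  obtain ⟨c, hc⟩ := Ideal.mem_span_range_iff_exists_fun.1 h
  have hg' : g = ∑ i, homogeneousComponent 1 (c i) * pderiv i f := by
    have hdeg : 1 + (d - 1) = d := by omega
    have hgd : homogeneousComponent d g = g := by
      rw [homogeneousComponent_of_mem hg, if_pos rfl]
    rw [← hgd, ← hc, map_sum]
    refine Finset.sum_congr rfl fun i _ => ?_
    rw [← homogeneousComponent_mul_of_isHomogeneous hf.pderiv, hdeg]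
  refine ⟨fun x => coeff (Finsupp.single x.2 1) (homogeneousComponent 1 (c x.1)), ?_⟩
  rw [hg', linDer]
  refine Finset.sum_congr rfl fun i _ => ?_
  conv_rhs => rw [eq_sum_of_isHomogeneous_one (homogeneousComponent_isHomogeneous 1 (c i)),
    Finset.sum_mul]
  exact Finset.sum_congr rfl fun j _ => (mul_assoc _ _ _).symm

theorem exists_eq_smul_of_linear_pow_eq {d : ℕ} (hd : 1 ≤ d) (a b : V → ℂ) (lam : ℂ)
    (h : (∑ i, C (a i) * X i) ^ d = lam • (∑ i, C (b i) * X i : MvPolynomial V ℂ) ^ d) :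
    ∃ c : ℂ, a = c • b := by
  classical
  by_cases ha : a = 0
  · exact ⟨0, by simp [ha]⟩
  obtain ⟨j, hj⟩ := Function.ne_iff.1 ha
  refine ⟨lam * b j ^ (d - 1) / a j ^ (d - 1), funext fun i => ?_⟩
  have hm : (Finsupp.single i 1 + Finsupp.single j (d - 1)).degree = d := by
    rw [map_add, Finsupp.degree_single, Finsupp.degree_single]
    omega
  have h1 := congrArg (dividedCoeff (Finsupp.single i 1 + Finsupp.single j (d - 1))) h
  have h2 : ∀ g : MvPolynomial V ℂ, ∀ m, dividedCoeff m (lam • g) = lam * dividedCoeff m g := by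
    intro g m
    simp only [dividedCoeff, coeff_smul, smul_eq_mul]
    ring
  have h3 : ∀ u : V → ℂ, ∏ k, u k ^ (Finsupp.single i 1 + Finsupp.single j (d - 1) : V →₀ ℕ) k =
      u i * u j ^ (d - 1) := by
    intro u
    simp only [Finsupp.add_apply, Finsupp.single_apply, pow_add, Finset.prod_mul_distrib, pow_ite,
      pow_one, pow_zero, Finset.prod_ite_eq, Finset.mem_univ, if_true]
  rw [h2, dividedCoeff_linear_pow _ _ _ hm, dividedCoeff_linear_pow _ _ _ hm, h3, h3] at h1
  have h4 : (d.factorial : ℂ) ≠ 0 := Nat.cast_ne_zero.2 (Nat.factorial_ne_zero d)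
  have h5 : a j ^ (d - 1) ≠ 0 := pow_ne_zero _ hj
  have h6 : a i * a j ^ (d - 1) = lam * (b i * b j ^ (d - 1)) :=
    mul_left_cancel₀ h4 (by linear_combination h1)
  rw [Pi.smul_apply, smul_eq_mul]
  field_simp
  linear_combination h6

end LinearForms

section Generic

variable {V : Type} [Fintype V] {d : ℕ}

/-- The matrix of linear forms, in the entries of a matrix `A`, whose values are divided
coefficients of `linDer A f`. -/
def shiftMatrix (r c : Fin 3 → V →₀ ℕ) (f : MvPolynomial V ℂ) :
    Matrix (Fin 3) (Fin 3) (MvPolynomial (V × V) ℂ) :=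
  Matrix.of fun s t => ∑ i, ∑ j, C ((r s + c t) j *
    dividedCoeff (r s + c t - Finsupp.single j 1 + Finsupp.single i 1) f) * X (i, j)

theorem eval_det_shiftMatrix (r c : Fin 3 → V →₀ ℕ) (f : MvPolynomial V ℂ) (A : V × V → ℂ) :
    eval A (shiftMatrix r c f).det =
      (Matrix.of fun s t => shiftSum A (fun m => dividedCoeff m f) (r s + c t)).det := by
  rw [RingHom.map_det]
  congr 1
  ext s t
  simp only [shiftMatrix, RingHom.mapMatrix_apply, Matrix.map_apply, Matrix.of_apply, map_sum,
    map_mul, eval_C, eval_X, shiftSum]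
  exact Finset.sum_congr rfl fun i _ => Finset.sum_congr rfl fun j _ => mul_comm _ _

theorem isHomogeneous_det_shiftMatrix (r c : Fin 3 → V →₀ ℕ) (f : MvPolynomial V ℂ) :
    (shiftMatrix r c f).det.IsHomogeneous 3 := by
  have h : ∀ s t, (shiftMatrix r c f s t).IsHomogeneous 1 := by
    intro s t
    refine IsHomogeneous.sum _ _ _ fun i _ => IsHomogeneous.sum _ _ _ fun j _ => ?_
    exact (isHomogeneous_X ℂ (i, j)).C_mul _
  have h3 : ∀ s t s' t' s'' t'', (shiftMatrix r c f s t * shiftMatrix r c f s' t' *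
      shiftMatrix r c f s'' t'').IsHomogeneous 3 := fun s t s' t' s'' t'' =>
    ((h s t).mul (h s' t')).mul (h s'' t'')
  rw [Matrix.det_fin_three]
  exact (((((h3 _ _ _ _ _ _).sub (h3 _ _ _ _ _ _)).sub (h3 _ _ _ _ _ _)).add
    (h3 _ _ _ _ _ _)).add (h3 _ _ _ _ _ _)).sub (h3 _ _ _ _ _ _)

theorem isPolyFamily_det_shiftMatrix (r c : Fin 3 → V →₀ ℕ) :
    IsPolyFamily fun f : homogeneousSubmodule V ℂ d =>
      (shiftMatrix r c (f : MvPolynomial V ℂ)).det := by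
  refine IsPolyFamily.det fun s t => ?_
  simp only [shiftMatrix, Matrix.of_apply]
  refine IsPolyFamily.sum _ fun i _ => IsPolyFamily.sum _ fun j _ =>
    (IsPolyFamily.C ?_).mul (IsPolyFamily.const _)
  have h : ∀ m : V →₀ ℕ, IsPolyFun fun f : homogeneousSubmodule V ℂ d =>
      coeff m (f : MvPolynomial V ℂ) := fun m =>
    IsPolyFun.of_linear ((lcoeff ℂ m).comp (homogeneousSubmodule V ℂ d).subtype)
  exact (IsPolyFun.const _).mul ((IsPolyFun.const _).mul (h _))

/-- If one system of divided coefficients has no nonzero linear vector field whose action has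
catalecticant rank at most two, then the same holds for generic forms. -/
theorem exists_isPolyFun_catalecticantRankLE [Nonempty V] (F : (V →₀ ℕ) → ℂ)
    (hF : ∀ A : V × V → ℂ, CatalecticantRankLE d (shiftSum A F) → A = 0) (hd : 2 ≤ d) :
    ∃ φ : homogeneousSubmodule V ℂ d → ℂ, IsPolyFun φ ∧ (∃ f, φ f ≠ 0) ∧
      ∀ f, φ f ≠ 0 → ∀ A : V × V → ℂ,
        CatalecticantRankLE d (shiftSum A fun m => dividedCoeff m (f : MvPolynomial V ℂ)) →
          A = 0 := by
  classical
  obtain ⟨f₀, hf₀, hF₀⟩ := exists_dividedCoeff_eq d F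
  let ι := {x : (Fin 3 → V →₀ ℕ) × (Fin 3 → V →₀ ℕ) //
    (∀ s, (x.1 s).degree = 2) ∧ ∀ t, (x.2 t).degree = d - 2}
  let P : ι → homogeneousSubmodule V ℂ d → MvPolynomial (V × V) ℂ := fun x f =>
    (shiftMatrix x.1.1 x.1.2 (f : MvPolynomial V ℂ)).det
  have hP : ∀ i f, (P i f).IsHomogeneous 3 := fun x f => isHomogeneous_det_shiftMatrix _ _ _
  have hc : ∀ i, IsPolyFamily (P i) := fun x => isPolyFamily_det_shiftMatrix _ _
  obtain ⟨φ, h1, h2, h3⟩ := exists_isPolyFun_forall_common_zero_eq_zero P hP hc ⟨f₀, hf₀⟩ (by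
    intro A hA
    refine hF A fun r c hr hc => ?_
    rw [← hA ⟨(r, c), hr, hc⟩, eval_det_shiftMatrix]
    congr 1
    ext s t
    refine (shiftSum_congr A hF₀ (d := d) ?_).symm
    rw [map_add, hr, hc]
    omega)
  refine ⟨φ, h1, ⟨_, h2⟩, fun f hf A hA => h3 f hf A fun x => ?_⟩
  rw [eval_det_shiftMatrix]
  exact hA _ _ x.2.1 x.2.2

end Generic

theorem pow_eq_smul_pow_of_sub_mem_jacobianIdeal {n d : ℕ} (hd : 2 ≤ d) {f x y : S n}
    (hf : f.IsHomogeneous d)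
    (h : ∀ A, CatalecticantRankLE d (shiftSum A fun m => dividedCoeff m f) → A = 0)
    (hx : x.IsHomogeneous 1) (hy : y.IsHomogeneous 1) (lam : ℂ)
    (hmem : x ^ d - lam • y ^ d ∈ jacobianIdeal f) : x ^ d = lam • y ^ d := by
  have hxd : (x ^ d).IsHomogeneous d := by simpa using hx.pow d
  have hyd : (lam • y ^ d).IsHomogeneous d :=
    (homogeneousSubmodule _ ℂ d).smul_mem lam (by simpa using hy.pow d)
  obtain ⟨A, hA⟩ := exists_linDer_eq_of_mem_span (by omega) hf (hxd.sub hyd) hmem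
  have hA0 : A = 0 := by
    refine h A fun r c hr hc => ?_
    simp only [← dividedCoeff_linDer, hA]
    rw [eq_sum_of_isHomogeneous_one hx, eq_sum_of_isHomogeneous_one hy]
    exact det_dividedCoeff_eq_zero hd _ _ lam r c hr hc
  rw [hA0] at hA
  rw [← sub_eq_zero, ← hA]
  simp [linDer]

theorem exists_separating_coefficients {n d : ℕ} (hd : 4 ≤ d) (hn : 2 ≤ n) :
    ∃ F : (Fin (n + 1) →₀ ℕ) → ℂ, ∀ A, CatalecticantRankLE d (shiftSum A F) → A = 0 := by
  rcases hd.eq_or_lt with rfl | hd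
  · obtain ⟨k, rfl⟩ := Nat.exists_eq_add_of_le' hn
    exact ⟨towerQuartic k, eq_zero_of_catalecticantRankLE_towerQuartic⟩
  · exact ⟨tripleIndicator d _, eq_zero_of_catalecticantRankLE_tripleIndicator hd (by simp; omega)⟩

/-- the Veronese map to `R_f^d` is well defined and injective.
For `d ≥ 4`, `n ≥ 2` and generic `f`: (a) for every nonzero linear form `x`, `x^d ∉ J_f`;
(b) if `x, y` are nonzero linear forms with `x^d` and `y^d` linearly dependent in `R_f^d`,
then `x` and `y` are proportional. -/
theorem veronese_in_jacobian_ring_injective (n d : ℕ) (hd : 4 ≤ d) (hn : 2 ≤ n) :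
    GenericallyHolds (fun f : MvPolynomial.homogeneousSubmodule (Fin (n + 1)) ℂ d =>
      (∀ x : S n, x.IsHomogeneous 1 → x ≠ 0 → x ^ d ∉ jacobianIdeal (f : S n)) ∧
      (∀ x y : S n, x.IsHomogeneous 1 → y.IsHomogeneous 1 → x ≠ 0 → y ≠ 0 →
        (∃ lam : ℂ, x ^ d - lam • y ^ d ∈ jacobianIdeal (f : S n)) →
        ∃ c : ℂ, x = c • y)) := by
  obtain ⟨F, hF⟩ := exists_separating_coefficients hd hn
  obtain ⟨φ, h1, h2, h3⟩ := exists_isPolyFun_catalecticantRankLE F hF (by omega)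
  refine ⟨φ, h1, h2, fun f hf => ⟨fun x hx hx0 hmem => ?_, fun x y hx hy _ _ ⟨lam, hmem⟩ => ?_⟩⟩
  · have h := pow_eq_smul_pow_of_sub_mem_jacobianIdeal (by omega) f.2 (h3 f hf) hx hx 0
      (by simpa using hmem)
    rw [zero_smul] at h
    exact hx0 (eq_zero_of_pow_eq_zero h)
  · have h := pow_eq_smul_pow_of_sub_mem_jacobianIdeal (by omega) f.2 (h3 f hf) hx hy lam hmem
    rw [eq_sum_of_isHomogeneous_one hx, eq_sum_of_isHomogeneous_one hy] at h
    obtain ⟨c, hc⟩ := exists_eq_smul_of_linear_pow_eq (by omega) _ _ lam h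
    refine ⟨c, ?_⟩
    rw [eq_sum_of_isHomogeneous_one hx, eq_sum_of_isHomogeneous_one hy, Finset.smul_sum]
    refine Finset.sum_congr rfl fun i _ => ?_
    rw [congrFun hc i, Pi.smul_apply, smul_eq_mul, C_mul, smul_eq_C_mul, mul_assoc]

end
end

section
/- Let d ≥ 3 and n ≥ 1. For generic (f, x) ∈ S^d × S^1 (i.e., for all (f, x) in some nonempty Zariski-open subset), the following holds: for all nonnegative integers k and l ≥ 1 with 2k + l ≤ (d−2)(n+1), the multiplication map by x^l from R_f^k to R_f^{k+l} is injective. In particular (taking l = 1): multiplication by x is injective on R_f^{2d-1} whenever 2(2d−1) < (d−2)(n+1), and injective on R_f^{3d-1} whenever 2(3d−1) < (d−2)(n+1). -/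
open MvPolynomial

noncomputable section

/-- The lowering operator of the `sl₂`-action on `ℂ[X]` for which multiplication by the sum of the
variables is the raising operator; it preserves the ideal of the powers `X i ^ (b + 2)`. -/
def lowering {σ : Type*} [Fintype σ] (b : ℕ) (p : MvPolynomial σ ℂ) : MvPolynomial σ ℂ :=
  ∑ i, (C ((b : ℂ) + 1) * pderiv i p - X i * pderiv i (pderiv i p))

/-- The ideal generated by the powers `X i ^ a` of the variables. -/
def powIdeal (σ : Type*) (a : ℕ) : Ideal (MvPolynomial σ ℂ) :=
  Ideal.span (Set.range fun i => X i ^ a)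

theorem X_pow_mem_powIdeal {σ : Type*} (i : σ) (a : ℕ) :
    (X i ^ a : MvPolynomial σ ℂ) ∈ powIdeal σ a :=
  Ideal.subset_span ⟨i, rfl⟩

section Lefschetz

variable {σ : Type*} [Fintype σ] {b : ℕ}

theorem lowering_add (p q : MvPolynomial σ ℂ) :
    lowering b (p + q) = lowering b p + lowering b q := by
  simp only [lowering, map_add, ← Finset.sum_add_distrib]
  exact Finset.sum_congr rfl fun i _ => by ring

theorem lowering_sum_X_mul {k : ℕ} {p : MvPolynomial σ ℂ} (hp : p.IsHomogeneous k) :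
    lowering b ((∑ i, X i) * p) = (∑ i, X i) * lowering b p +
      C ((b + 1) * Fintype.card σ - 2 * k : ℂ) * p := by
  classical
  have hE := hp.sum_X_mul_pderiv
  have h : ∀ i : σ, C ((b : ℂ) + 1) * pderiv i ((∑ i, X i) * p) -
      X i * pderiv i (pderiv i ((∑ i, X i) * p)) =
      (∑ i, X i) * (C ((b : ℂ) + 1) * pderiv i p - X i * pderiv i (pderiv i p)) +
        (C ((b : ℂ) + 1) * p - 2 * (X i * pderiv i p)) := by
    intro i
    have h1 : pderiv i (∑ j : σ, X j : MvPolynomial σ ℂ) = 1 := by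
      simp [map_sum, pderiv_X, Pi.single_apply]
    simp only [pderiv_mul, map_add, h1, one_mul]
    ring
  unfold lowering
  rw [Finset.sum_congr rfl fun i _ => h i, Finset.sum_add_distrib, ← Finset.mul_sum,
    Finset.sum_sub_distrib (f := fun _ => _ * p), ← Finset.mul_sum Finset.univ _ 2, hE]
  simp only [Finset.sum_const, Finset.card_univ, nsmul_eq_mul, map_sub, map_mul, map_add,
    map_natCast, map_one, map_ofNat]
  ring

theorem MvPolynomial.IsHomogeneous.lowering {k : ℕ} {p : MvPolynomial σ ℂ}
    (hp : p.IsHomogeneous (k + 1)) :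
    (lowering b p).IsHomogeneous k := by
  refine IsHomogeneous.sum _ _ _ fun i _ => ?_
  have h1 : (pderiv i p).IsHomogeneous k := hp.pderiv
  refine (h1.C_mul _).sub ?_
  cases k with
  | zero =>
    rw [← totalDegree_zero_iff_isHomogeneous, totalDegree_eq_zero_iff_eq_C] at h1
    rw [h1, pderiv_C, mul_zero]
    exact isHomogeneous_zero _ _ _
  | succ k =>
    have h2 : (pderiv i (pderiv i p)).IsHomogeneous k := h1.pderiv
    rw [add_comm k 1]
    exact (isHomogeneous_X ℂ i).mul h2

theorem lowering_eq_zero {p : MvPolynomial σ ℂ} (hp : p.IsHomogeneous 0) :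
    lowering b p = 0 := by
  rw [← totalDegree_zero_iff_isHomogeneous, totalDegree_eq_zero_iff_eq_C] at hp
  rw [hp]
  simp [lowering]

theorem lowering_mul_X_pow_mem (i : σ) (g : MvPolynomial σ ℂ) :
    lowering b (g * X i ^ (b + 2)) ∈ powIdeal σ (b + 2) := by
  classical
  refine sum_mem fun j _ => ?_
  rcases eq_or_ne i j with rfl | hij
  · convert Ideal.mul_mem_left _ (C ((b : ℂ) + 1) * pderiv i g - X i * pderiv i (pderiv i g) -
      C (2 * (b + 2) : ℂ) * pderiv i g) (X_pow_mem_powIdeal i (b + 2)) using 1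
    simp only [pderiv_mul, pderiv_pow, map_add, pderiv_X_self, Derivation.map_natCast, map_mul,
      map_natCast, map_one, map_ofNat]
    simp
    ring
  · convert Ideal.mul_mem_left _ (C ((b : ℂ) + 1) * pderiv j g - X j * pderiv j (pderiv j g))
      (X_pow_mem_powIdeal i (b + 2)) using 1
    have h0 : pderiv j (X i ^ (b + 2) : MvPolynomial σ ℂ) = 0 := by
      rw [pderiv_pow, pderiv_X_of_ne hij, mul_zero]
    simp only [pderiv_mul, h0, mul_zero, add_zero]
    ring

theorem lowering_mem_powIdeal {p : MvPolynomial σ ℂ} (hp : p ∈ powIdeal σ (b + 2)) :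
    lowering b p ∈ powIdeal σ (b + 2) := by
  obtain ⟨c, rfl⟩ := Ideal.mem_span_range_iff_exists_fun.1 hp
  refine Finset.sum_induction _ (fun p => lowering b p ∈ powIdeal σ (b + 2)) ?_ ?_
    fun i _ => lowering_mul_X_pow_mem i (c i)
  · intro p q hp hq
    rw [lowering_add]
    exact add_mem hp hq
  · simp [lowering]

theorem lowering_sum_X_pow_mul {k : ℕ} {p : MvPolynomial σ ℂ} (hp : p.IsHomogeneous k) (l : ℕ) :
    lowering b ((∑ i, X i) ^ (l + 1) * p) = (∑ i, X i) ^ (l + 1) * lowering b p +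
      C ((l + 1) * ((b + 1) * Fintype.card σ - 2 * k - l) : ℂ) * ((∑ i, X i) ^ l * p) := by
  induction l with
  | zero => simpa using lowering_sum_X_mul (b := b) hp
  | succ l ih =>
    have hX : (∑ i, X i : MvPolynomial σ ℂ).IsHomogeneous 1 :=
      IsHomogeneous.sum _ _ _ fun i _ => isHomogeneous_X ℂ i
    rw [pow_succ' _ (l + 1), mul_assoc, lowering_sum_X_mul ((hX.pow (l + 1)).mul hp), ih]
    push_cast
    simp only [map_add, map_sub, map_mul, map_one, map_natCast, map_ofNat]
    ring

theorem mem_of_lowering_mem {k l : ℕ} {p : MvPolynomial σ ℂ}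
    (hp : p.IsHomogeneous k) (hkl : 2 * k + (l + 1) ≤ (b + 1) * Fintype.card σ)
    (hlow : (∑ i, X i) ^ (l + 1) * lowering b p ∈ powIdeal σ (b + 2))
    (h : (∑ i, X i) ^ (l + 1) * p ∈ powIdeal σ (b + 2)) :
    (∑ i, X i) ^ l * p ∈ powIdeal σ (b + 2) := by
  have h1 := lowering_mem_powIdeal h
  rw [lowering_sum_X_pow_mul hp, add_mem_cancel_left hlow] at h1
  obtain ⟨m, hm⟩ := Nat.exists_eq_add_of_le hkl
  have hc : ((l + 1) * ((b + 1) * Fintype.card σ - 2 * k - l) : ℂ) = (l + 1) * (m + 1) := by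
    have : ((b + 1) * Fintype.card σ : ℂ) = 2 * k + (l + 1) + m := by exact_mod_cast hm
    rw [this]
    ring
  have hc0 : ((l + 1) * (m + 1) : ℂ) ≠ 0 := by
    exact_mod_cast Nat.mul_ne_zero l.succ_ne_zero m.succ_ne_zero
  rw [hc] at h1
  have h2 := Ideal.mul_mem_left _ (C ((l + 1) * (m + 1) : ℂ)⁻¹) h1
  rwa [← mul_assoc, ← C_mul, inv_mul_cancel₀ hc0, C_1, one_mul] at h2

/-- The strong Lefschetz property of `ℂ[X] / (X i ^ (b + 2))`. -/
theorem mem_powIdeal_of_sum_X_pow_mul_mem {k l : ℕ} {p : MvPolynomial σ ℂ}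
    (hp : p.IsHomogeneous k) (hkl : 2 * k + l ≤ (b + 1) * Fintype.card σ)
    (h : (∑ i, X i) ^ l * p ∈ powIdeal σ (b + 2)) : p ∈ powIdeal σ (b + 2) := by
  induction k generalizing l p with
  | zero =>
    induction l with
    | zero => simpa using h
    | succ l ihl =>
      refine ihl (by omega) (mem_of_lowering_mem hp hkl ?_ h)
      simp [lowering_eq_zero hp]
  | succ k ihk =>
    induction l with
    | zero => simpa using h
    | succ l ihl =>
      refine ihl (by omega) (mem_of_lowering_mem hp hkl ?_ h)
      have h1 := lowering_mem_powIdeal h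
      rw [lowering_sum_X_pow_mul hp] at h1
      have h2 : (∑ i, X i) ^ (l + 2) * lowering b p ∈ powIdeal σ (b + 2) := by
        convert sub_mem (Ideal.mul_mem_left _ (∑ i, X i) h1) (Ideal.mul_mem_left _
          (C ((l + 1) * ((b + 1) * Fintype.card σ - 2 * (k + 1 : ℕ) - l) : ℂ)) h) using 1
        ring
      exact Ideal.mul_mem_left _ _ (ihk hp.lowering (by omega) h2)

end Lefschetz

section Koszul

variable {σ : Type*}

theorem mem_span_X_pow_of_mul_X_pow_mem {s : Set σ} {t : σ} (ht : t ∉ s) {a : ℕ}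
    {g : MvPolynomial σ ℂ} (h : g * X t ^ a ∈ Ideal.span ((fun i => X i ^ a) '' s)) :
    g ∈ Ideal.span ((fun i => X i ^ a : σ → MvPolynomial σ ℂ) '' s) := by
  classical
  have hs : (fun i => X i ^ a : σ → MvPolynomial σ ℂ) '' s =
      (fun u => monomial u (1 : ℂ)) '' ((fun i => Finsupp.single i a) '' s) := by
    rw [Set.image_image]
    simp only [X_pow_eq_monomial]
  rw [hs, mem_ideal_span_monomial_image] at h ⊢
  intro m hm
  obtain ⟨_, ⟨j, hj, rfl⟩, hle⟩ := h (m + Finsupp.single t a) (by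
    rwa [mem_support_iff, X_pow_eq_monomial, coeff_mul_monomial, mul_one, ← mem_support_iff])
  refine ⟨_, ⟨j, hj, rfl⟩, ?_⟩
  have hjt : t ≠ j := fun h => ht (h ▸ hj)
  simpa [Finsupp.single_le_iff, Finsupp.single_eq_of_ne hjt, Finsupp.single_eq_of_ne hjt.symm]
    using hle

/-- The syzygies of the powers of the variables are generated by the Koszul syzygies. -/
theorem exists_koszul_of_sum_mul_X_pow_eq_zero (a : ℕ) (s : Finset σ) (e : σ → MvPolynomial σ ℂ)
    (he : ∑ i ∈ s, e i * X i ^ a = 0) :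
    ∃ c : σ → σ → MvPolynomial σ ℂ, ∀ i ∈ s, e i = ∑ j ∈ s, (c i j - c j i) * X j ^ a := by
  classical
  induction s using Finset.induction_on generalizing e with
  | empty => exact ⟨0, by simp⟩
  | insert t s hts ih =>
    rw [Finset.sum_insert hts] at he
    have hmem : e t ∈ Ideal.span ((fun i => X i ^ a : σ → MvPolynomial σ ℂ) '' (s : Set σ)) := by
      refine mem_span_X_pow_of_mul_X_pow_mem (t := t) (by simpa using hts) ?_
      rw [eq_neg_of_add_eq_zero_left he]
      exact neg_mem (sum_mem fun i hi => Ideal.mul_mem_left _ _ (Ideal.subset_span ⟨i, hi, rfl⟩))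
    obtain ⟨g, hg⟩ : ∃ g : σ → MvPolynomial σ ℂ, ∑ j ∈ s, g j * X j ^ a = e t := by
      obtain ⟨g, hg⟩ := (Submodule.mem_span_image_finset_iff_exists_fun _).1 hmem
      refine ⟨Function.extend Subtype.val g 0, ?_⟩
      rw [← hg, ← Finset.sum_coe_sort]
      exact Finset.sum_congr rfl fun j _ => by rw [Subtype.val_injective.extend_apply, smul_eq_mul]
    obtain ⟨c, hc⟩ := ih (fun i => e i + g i * X t ^ a) (by
      rw [← he, ← hg, Finset.sum_mul, add_comm, ← Finset.sum_add_distrib]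
      exact Finset.sum_congr rfl fun i _ => by ring)
    refine ⟨fun i j => if i = t then (if j = t then 0 else g j) else if j = t then 0 else c i j,
      fun i hi => ?_⟩
    have hne : ∀ j ∈ s, j ≠ t := fun j hj h => hts (h ▸ hj)
    rw [Finset.sum_insert hts]
    rcases Finset.mem_insert.1 hi with rfl | hi
    · rw [← hg]
      simp only [if_true, sub_self, zero_mul, zero_add]
      exact Finset.sum_congr rfl fun j hj => by simp [hne j hj]
    · have h1 := hc i hi
      rw [← sub_eq_iff_eq_add.2 h1.symm, sub_eq_neg_add]
      simp only [if_neg (hne i hi), if_true, zero_sub, neg_mul]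
      exact congrArg _ (Finset.sum_congr rfl fun j hj => by simp [hne j hj])

end Koszul

section Shifted

variable {σ : Type*}

/-- The forms whose product with a form of degree `e` has degree `m`: the piece of degree
`m - e`, which is zero if `m < e`. -/
def shiftedPiece (σ : Type*) (m e : ℕ) : Submodule ℂ (MvPolynomial σ ℂ) :=
  if e ≤ m then homogeneousSubmodule σ ℂ (m - e) else ⊥

/-- The projection onto `shiftedPiece σ m e`. -/
def shiftedComponent (m e : ℕ) : MvPolynomial σ ℂ →ₗ[ℂ] MvPolynomial σ ℂ :=
  if e ≤ m then homogeneousComponent (m - e) else 0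

theorem shiftedPiece_fg [Finite σ] (m e : ℕ) : (shiftedPiece σ m e).FG := by
  unfold shiftedPiece
  split_ifs
  · exact homogeneousSubmodule_fg _ _ _
  · exact Submodule.fg_bot

theorem shiftedComponent_mem (m e : ℕ) (p : MvPolynomial σ ℂ) :
    shiftedComponent m e p ∈ shiftedPiece σ m e := by
  unfold shiftedPiece shiftedComponent
  split_ifs
  · exact homogeneousComponent_mem _ _
  · simp

theorem shiftedComponent_eq_self {m e : ℕ} {p : MvPolynomial σ ℂ} (hp : p ∈ shiftedPiece σ m e) :
    shiftedComponent m e p = p := by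
  unfold shiftedPiece at hp
  unfold shiftedComponent
  split_ifs at hp ⊢
  · exact homogeneousComponent_eq_self hp
  · simpa using hp.symm

theorem homogeneousComponent_mul_of_isHomogeneous_s8 {q : MvPolynomial σ ℂ} {e : ℕ}
    (hq : q.IsHomogeneous e) (m : ℕ) (p : MvPolynomial σ ℂ) :
    homogeneousComponent m (p * q) = shiftedComponent m e p * q := by
  let : GradedAlgebra (homogeneousSubmodule σ ℂ) := MvPolynomial.gradedAlgebra
  have h := DirectSum.coe_decompose_mul_of_right_mem (homogeneousSubmodule σ ℂ) (a := p) m hq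
  have hd : ∀ (r : MvPolynomial σ ℂ) i,
      (DirectSum.decompose (homogeneousSubmodule σ ℂ) r i : MvPolynomial σ ℂ) =
        homogeneousComponent i r := decomposition.decompose'_apply
  rw [hd, hd] at h
  rw [h, shiftedComponent]
  split_ifs <;> simp

theorem shiftedComponent_mul {q : MvPolynomial σ ℂ} {e : ℕ} (hq : q.IsHomogeneous e) (m e' : ℕ)
    (p : MvPolynomial σ ℂ) :
    shiftedComponent m e' (p * q) = shiftedComponent m (e + e') p * q := by
  by_cases h : e' ≤ m
  · rw [shiftedComponent, if_pos h, homogeneousComponent_mul_of_isHomogeneous_s8 hq]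
    by_cases h' : e + e' ≤ m
    · rw [shiftedComponent, shiftedComponent, if_pos h', if_pos (by omega), Nat.sub_sub,
        add_comm e']
    · rw [shiftedComponent, shiftedComponent, if_neg h', if_neg (by omega)]
  · rw [shiftedComponent, shiftedComponent, if_neg h, if_neg (by omega)]
    simp

theorem mul_mem_shiftedPiece {p q : MvPolynomial σ ℂ} {m e e' : ℕ}
    (hp : p ∈ shiftedPiece σ m (e + e')) (hq : q.IsHomogeneous e) :
    p * q ∈ shiftedPiece σ m e' := by
  rw [← shiftedComponent_eq_self hp, ← shiftedComponent_mul hq]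
  exact shiftedComponent_mem _ _ _

theorem mul_mem_shiftedPiece_add {p q : MvPolynomial σ ℂ} {k l e : ℕ}
    (hp : p ∈ shiftedPiece σ k e) (hq : q.IsHomogeneous l) :
    q * p ∈ shiftedPiece σ (k + l) e := by
  unfold shiftedPiece at hp ⊢
  by_cases h : e ≤ k
  · rw [if_pos h] at hp
    rw [if_pos (by omega), show k + l - e = l + (k - e) by omega]
    exact hq.mul hp
  · rw [if_neg h, Submodule.mem_bot] at hp
    rw [hp, mul_zero]
    exact zero_mem _

theorem mem_shiftedPiece_zero {p : MvPolynomial σ ℂ} {m : ℕ} :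
    p ∈ shiftedPiece σ m 0 ↔ p.IsHomogeneous m := by
  simp [shiftedPiece]

theorem exists_shifted_of_mem_powIdeal [Fintype σ] {p : MvPolynomial σ ℂ} {k a : ℕ}
    (hp : p.IsHomogeneous k) (h : p ∈ powIdeal σ a) :
    ∃ b : σ → MvPolynomial σ ℂ, (∀ i, b i ∈ shiftedPiece σ k a) ∧ p = ∑ i, b i * X i ^ a := by
  obtain ⟨c, hc⟩ := Ideal.mem_span_range_iff_exists_fun.1 h
  refine ⟨fun i => shiftedComponent k a (c i), fun i => shiftedComponent_mem _ _ _, ?_⟩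
  have := congrArg (homogeneousComponent k) hc
  rw [homogeneousComponent_eq_self hp, map_sum] at this
  rw [← this]
  exact Finset.sum_congr rfl fun i _ =>
    homogeneousComponent_mul_of_isHomogeneous_s8 (isHomogeneous_X_pow i a) _ _

theorem exists_shifted_koszul [Fintype σ] {m a : ℕ} {e : σ → MvPolynomial σ ℂ}
    (he : ∀ i, e i ∈ shiftedPiece σ m a) (h : ∑ i, e i * X i ^ a = 0) :
    ∃ c : σ → σ → MvPolynomial σ ℂ, (∀ i j, c i j ∈ shiftedPiece σ m (a + a)) ∧
      ∀ i, e i = ∑ j, (c i j - c j i) * X j ^ a := by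
  obtain ⟨c, hc⟩ := exists_koszul_of_sum_mul_X_pow_eq_zero a Finset.univ e h
  refine ⟨fun i j => shiftedComponent m (a + a) (c i j), fun i j => shiftedComponent_mem _ _ _,
    fun i => ?_⟩
  have := congrArg (shiftedComponent m a) (hc i (Finset.mem_univ i))
  rw [shiftedComponent_eq_self (he i), map_sum] at this
  rw [this]
  refine Finset.sum_congr rfl fun j _ => ?_
  rw [shiftedComponent_mul (isHomogeneous_X_pow j a), map_sub]

end Shifted

section PolyMap

variable {M : Type} [AddCommGroup M] [Module ℂ M]

/-- The polynomial maps from `M` to `V`: the finite sums of constant vectors with polynomial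
functions as coefficients. -/
def polyMap (M : Type) [AddCommGroup M] [Module ℂ M] (V : Type*) [AddCommGroup V] [Module ℂ V] :
    Submodule ℂ (M → V) :=
  Submodule.span ℂ {F | ∃ (φ : M → ℂ) (v : V), IsPolyFun φ ∧ F = fun z => φ z • v}

variable {V W U : Type*} [AddCommGroup V] [Module ℂ V] [AddCommGroup W] [Module ℂ W]
  [AddCommGroup U] [Module ℂ U]

theorem const_mem_polyMap (v : V) : (fun _ => v) ∈ polyMap M V :=
  Submodule.subset_span ⟨1, v, one_mem _, by simp⟩

theorem linearMap_mem_polyMap [FiniteDimensional ℂ M] (L : M →ₗ[ℂ] V) : ⇑L ∈ polyMap M V := by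
  let b := Module.finBasis ℂ M
  have : ⇑L = ∑ i, fun z => b.coord i z • L (b i) := by
    funext z
    conv_lhs => rw [← b.sum_repr z, map_sum]
    simp
  rw [this]
  exact sum_mem fun i _ => Submodule.subset_span
    ⟨b.coord i, L (b i), Algebra.subset_adjoin ⟨b.coord i, rfl⟩, rfl⟩

theorem bilin_mem_polyMap (B : V →ₗ[ℂ] W →ₗ[ℂ] U) {F : M → V} {G : M → W}
    (hF : F ∈ polyMap M V) (hG : G ∈ polyMap M W) : (fun z => B (F z) (G z)) ∈ polyMap M U := by
  induction hF, hG using Submodule.span_induction₂ with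
  | mem_mem F G hF hG =>
    obtain ⟨φ, v, hφ, rfl⟩ := hF
    obtain ⟨ψ, w, hψ, rfl⟩ := hG
    exact Submodule.subset_span ⟨φ * ψ, B v w, mul_mem hφ hψ, by
      funext z
      simp [mul_smul, smul_comm (ψ z)]⟩
  | zero_left G hG => convert zero_mem (polyMap M U) using 1; funext z; simp
  | zero_right F hF => convert zero_mem (polyMap M U) using 1; funext z; simp
  | add_left F F' G _ _ _ h h' => convert add_mem h h' using 1; funext z; simp
  | add_right F G G' _ _ _ h h' => convert add_mem h h' using 1; funext z; simp
  | smul_left r F G _ _ h => convert Submodule.smul_mem _ r h using 1; funext z; simp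
  | smul_right r F G _ _ h => convert Submodule.smul_mem _ r h using 1; funext z; simp

theorem comp_mem_polyMap (L : V →ₗ[ℂ] W) {F : M → V} (hF : F ∈ polyMap M V) :
    (fun z => L (F z)) ∈ polyMap M W := by
  simpa using bilin_mem_polyMap ((LinearMap.lsmul ℂ W).flip.comp L) hF
    (const_mem_polyMap (1 : ℂ))

theorem isPolyFun_of_mem_polyMap {F : M → ℂ} (hF : F ∈ polyMap M ℂ) : IsPolyFun F := by
  suffices h : polyMap M ℂ ≤
      Subalgebra.toSubmodule (Algebra.adjoin ℂ {ψ : M → ℂ | ∃ l : M →ₗ[ℂ] ℂ, ψ = ⇑l}) from h hF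
  refine Submodule.span_le.2 ?_
  rintro _ ⟨φ, c, hφ, rfl⟩
  have : (fun z => φ z • c) = c • φ := by
    funext z
    simp [mul_comm]
  rw [this]
  exact Subalgebra.smul_mem _ hφ c

theorem mul_mem_polyMap {A : Type*} [CommRing A] [Algebra ℂ A] {F G : M → A}
    (hF : F ∈ polyMap M A) (hG : G ∈ polyMap M A) : (fun z => F z * G z) ∈ polyMap M A :=
  bilin_mem_polyMap (LinearMap.mul ℂ A) hF hG

theorem pow_mem_polyMap {A : Type*} [CommRing A] [Algebra ℂ A] {F : M → A}
    (hF : F ∈ polyMap M A) (l : ℕ) : (fun z => F z ^ l) ∈ polyMap M A := by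
  induction l with
  | zero => simpa using const_mem_polyMap (M := M) (1 : A)
  | succ l ih => simpa only [pow_succ] using mul_mem_polyMap ih hF

theorem sum_mem_polyMap {ι : Type*} (s : Finset ι) {F : ι → M → V}
    (hF : ∀ i ∈ s, F i ∈ polyMap M V) : (fun z => ∑ i ∈ s, F i z) ∈ polyMap M V := by
  simpa [← Finset.sum_apply] using sum_mem hF

theorem pi_mem_polyMap {ι : Type*} [Fintype ι] {F : M → ι → V}
    (hF : ∀ i, (fun z => F z i) ∈ polyMap M V) : F ∈ polyMap M (ι → V) := by
  classical
  have : F = fun z => ∑ i, LinearMap.single ℂ (fun _ : ι => V) i (F z i) := by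
    funext z
    simp [Finset.univ_sum_single]
  rw [this]
  exact sum_mem_polyMap _ fun i _ => comp_mem_polyMap _ (hF i)

theorem prodMk_mem_polyMap {F : M → V} {G : M → W} (hF : F ∈ polyMap M V)
    (hG : G ∈ polyMap M W) : (fun z => (F z, G z)) ∈ polyMap M (V × W) := by
  convert add_mem (comp_mem_polyMap (LinearMap.inl ℂ V W) hF)
    (comp_mem_polyMap (LinearMap.inr ℂ V W) hG) using 1
  funext z
  simp

/-- Linear independence of a finite family of polynomial maps is an open condition. -/
theorem exists_isPolyFun_linearIndependent {r : ℕ} {w : Fin r → M → V}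
    (hw : ∀ i, w i ∈ polyMap M V) {z₀ : M} (h : LinearIndependent ℂ fun i => w i z₀) :
    ∃ φ : M → ℂ, IsPolyFun φ ∧ φ z₀ ≠ 0 ∧
      ∀ z, φ z ≠ 0 → LinearIndependent ℂ fun i => w i z := by
  obtain ⟨L, hL⟩ := LinearMap.exists_leftInverse_of_injective
    (Fintype.linearCombination ℂ fun i => w i z₀) (LinearMap.ker_eq_bot.2
      h.fintypeLinearCombination_injective)
  let N : M → Matrix (Fin r) (Fin r) ℂ := fun z => Matrix.of fun i j => L (w i z) j
  refine ⟨fun z => (N z).det, ?_, ?_, fun z hz => ?_⟩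
  · have hN : ∀ i j, (fun z => N z i j) ∈ polyMap M ℂ := fun i j =>
      comp_mem_polyMap ((LinearMap.proj j).comp L) (hw i)
    have : (fun z => (N z).det) = ∑ σ : Equiv.Perm (Fin r),
        ((Equiv.Perm.sign σ : ℤ) : ℂ) • ∏ i, fun z => N z (σ i) i := by
      funext z
      simp [Matrix.det_apply, Units.smul_def, zsmul_eq_mul]
    rw [this]
    exact sum_mem fun σ _ => Subalgebra.smul_mem _
      (prod_mem fun i _ => isPolyFun_of_mem_polyMap (hN _ _)) _
  · have : N z₀ = 1 := by
      ext i j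
      have := LinearMap.congr_fun hL (Pi.single i 1)
      simp only [LinearMap.comp_apply, Fintype.linearCombination_apply_single, one_smul,
        LinearMap.id_apply] at this
      simp [N, this, Matrix.one_apply, Pi.single_apply, eq_comm]
    simp [this]
  · have hli : LinearIndependent ℂ (N z).row :=
      Matrix.linearIndependent_rows_iff_isUnit.2 ((Matrix.isUnit_iff_isUnit_det _).2 hz.isUnit)
    exact LinearIndependent.of_comp L hli

/-- Exactness of a polynomial family of complexes is an open condition. -/
theorem exists_isPolyFun_exact {ι : Type*} (B : Submodule ℂ V) [FiniteDimensional ℂ B]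
    (v : M → ι → V) (β : M → V →ₗ[ℂ] W) (hvB : ∀ z i, v z i ∈ B) (hβv : ∀ z i, β z (v z i) = 0)
    (hv : ∀ i, (fun z => v z i) ∈ polyMap M V) (hβ : ∀ b, (fun z => β z b) ∈ polyMap M W) {z₀ : M}
    (hex : ∀ b ∈ B, β z₀ b = 0 → b ∈ Submodule.span ℂ (Set.range (v z₀))) :
    ∃ φ : M → ℂ, IsPolyFun φ ∧ φ z₀ ≠ 0 ∧ ∀ z, φ z ≠ 0 →
      ∀ b ∈ B, β z b = 0 → b ∈ Submodule.span ℂ (Set.range (v z)) := by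
  let K : M → Submodule ℂ V := fun z => (LinearMap.ker ((β z).domRestrict B)).map B.subtype
  have hmemK : ∀ z b, b ∈ K z ↔ b ∈ B ∧ β z b = 0 := by
    intro z b
    simp [K, and_comm]
  have hle : ∀ z, Submodule.span ℂ (Set.range (v z)) ≤ K z := fun z =>
    Submodule.span_le.2 (by rintro _ ⟨i, rfl⟩; exact (hmemK z _).2 ⟨hvB z i, hβv z i⟩)
  have hKB : ∀ z, K z ≤ B := fun z b hb => ((hmemK z b).1 hb).1
  have hfK : ∀ z, FiniteDimensional ℂ (K z) := fun z =>
    Submodule.finiteDimensional_of_le (hKB z)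
  have hfs : ∀ z, FiniteDimensional ℂ (Submodule.span ℂ (Set.range (v z))) := fun z =>
    Submodule.finiteDimensional_of_le (hle z)
  have hrank : ∀ z, Module.finrank ℂ (LinearMap.range ((β z).domRestrict B)) +
      Module.finrank ℂ (K z) = Module.finrank ℂ B := fun z => by
    rw [Submodule.finrank_map_subtype_eq]
    exact LinearMap.finrank_range_add_finrank_ker _
  have heq₀ : Submodule.span ℂ (Set.range (v z₀)) = K z₀ :=
    le_antisymm (hle z₀) fun b hb => hex b ((hmemK z₀ b).1 hb).1 ((hmemK z₀ b).1 hb).2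
  have := hfs z₀
  obtain ⟨f, hf, -, hfli⟩ := Submodule.exists_fun_fin_finrank_span_eq ℂ (Set.range (v z₀))
  choose i hi using hf
  have hspan : Submodule.span ℂ (Set.range ((β z₀).domRestrict B)) =
      LinearMap.range ((β z₀).domRestrict B) := by
    rw [← LinearMap.coe_range, Submodule.span_eq]
  have : FiniteDimensional ℂ (Submodule.span ℂ (Set.range ((β z₀).domRestrict B))) := by
    rw [hspan]
    infer_instance
  obtain ⟨g, hg, -, hgli⟩ :=
    Submodule.exists_fun_fin_finrank_span_eq ℂ (Set.range ((β z₀).domRestrict B))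
  choose j hj using hg
  obtain ⟨φ, hφ, hφ₀, hφli⟩ := exists_isPolyFun_linearIndependent (z₀ := z₀)
    (fun t => hv (i t)) (by simpa only [hi] using hfli)
  obtain ⟨ψ, hψ, hψ₀, hψli⟩ := exists_isPolyFun_linearIndependent (z₀ := z₀)
    (w := fun t z => (β z).domRestrict B (j t)) (fun t => hβ (j t)) (by simpa only [hj] using hgli)
  refine ⟨φ * ψ, mul_mem hφ hψ, mul_ne_zero hφ₀ hψ₀, fun z hz b hb hbz => ?_⟩
  have h1 : Module.finrank ℂ (K z₀) ≤ Module.finrank ℂ (Submodule.span ℂ (Set.range (v z))) := by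
    have hli := hφli z (left_ne_zero_of_mul hz)
    rw [← heq₀, ← Fintype.card_fin (Module.finrank ℂ _), ← finrank_span_eq_card hli]
    have := hfs z
    exact Submodule.finrank_mono (Submodule.span_mono (by rintro _ ⟨t, rfl⟩; exact ⟨i t, rfl⟩))
  have h2 : Module.finrank ℂ (LinearMap.range ((β z₀).domRestrict B)) ≤
      Module.finrank ℂ (LinearMap.range ((β z).domRestrict B)) := by
    have hli := hψli z (right_ne_zero_of_mul hz)
    rw [← hspan, ← Fintype.card_fin (Module.finrank ℂ _), ← finrank_span_eq_card hli]
    exact Submodule.finrank_mono (Submodule.span_le.2 (by rintro _ ⟨t, rfl⟩; exact ⟨j t, rfl⟩))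
  have := hfK z
  rw [Submodule.eq_of_le_of_finrank_le (hle z) (by have := hrank z; have := hrank z₀; omega)]
  exact (hmemK z b).2 ⟨hb, hbz⟩

end PolyMap

section Generic

variable {n d : ℕ}

/-- The vectors `(p, a)` with `x ^ l * p = ∑ i, a i * ∂f/∂X i` live in this space. -/
def relationSpace (n k m a : ℕ) : Submodule ℂ (S n × (Fin (n + 1) → S n)) :=
  (homogeneousSubmodule (Fin (n + 1)) ℂ k).prod
    (Submodule.pi Set.univ fun _ => shiftedPiece (Fin (n + 1)) m a)

theorem mem_relationSpace {k m a : ℕ} {y : S n × (Fin (n + 1) → S n)} :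
    y ∈ relationSpace n k m a ↔
      y.1.IsHomogeneous k ∧ ∀ i, y.2 i ∈ shiftedPiece (Fin (n + 1)) m a := by
  simp [relationSpace, Submodule.mem_prod, mem_homogeneousSubmodule]

instance (k m a : ℕ) : FiniteDimensional ℂ (relationSpace n k m a) :=
  Module.Finite.iff_fg.2 ((homogeneousSubmodule_fg _ _ _).prod
    (Submodule.fg_pi fun _ => shiftedPiece_fg m a))

/-- The map `(p, a) ↦ x ^ l * p - ∑ i, a i * ∂f/∂X i`. -/
def relationMap (l : ℕ) (f x : S n) : S n × (Fin (n + 1) → S n) →ₗ[ℂ] S n :=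
  (LinearMap.mulLeft ℂ (x ^ l)).comp (LinearMap.fst ℂ _ _) -
    ∑ i, (LinearMap.mulRight ℂ (pderiv i f)).comp
      ((LinearMap.proj i).comp (LinearMap.snd ℂ _ _))

theorem relationMap_apply (l : ℕ) (f x : S n) (y : S n × (Fin (n + 1) → S n)) :
    relationMap l f x y = x ^ l * y.1 - ∑ i, y.2 i * pderiv i f := by
  simp [relationMap]

/-- The parameters of the obvious elements in the kernel of `relationMap`. -/
abbrev TrivialRelation (n k m a : ℕ) : Type :=
  (Fin (n + 1) → shiftedPiece (Fin (n + 1)) k a) ×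
    (Fin (n + 1) → Fin (n + 1) → shiftedPiece (Fin (n + 1)) m (a + a))

/-- The obvious elements in the kernel of `relationMap`. -/
def trivialRelation {k m a : ℕ} (l : ℕ) (f x : S n) (t : TrivialRelation n k m a) :
    S n × (Fin (n + 1) → S n) :=
  (∑ i, (t.1 i : S n) * pderiv i f,
    fun i => x ^ l * t.1 i + ∑ j, ((t.2 i j : S n) - t.2 j i) * pderiv j f)

theorem relationMap_trivialRelation {k m a : ℕ} (l : ℕ) (f x : S n)
    (t : TrivialRelation n k m a) : relationMap l f x (trivialRelation l f x t) = 0 := by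
  rw [relationMap_apply]
  simp only [trivialRelation, add_mul, Finset.sum_add_distrib, Finset.mul_sum, Finset.sum_mul,
    sub_mul, Finset.sum_sub_distrib]
  rw [Finset.sum_comm (f := fun i j => (t.2 j i : S n) * pderiv j f * pderiv i f)]
  simp only [mul_assoc, mul_comm (pderiv _ f) (pderiv _ f)]
  ring

theorem trivialRelation_mem {k l a : ℕ} {f x : S n} (hf : f.IsHomogeneous (a + 1))
    (hx : x.IsHomogeneous 1) (t : TrivialRelation n k (k + l) a) :
    trivialRelation l f x t ∈ relationSpace n k (k + l) a := by
  have hp : ∀ i, (pderiv i f).IsHomogeneous a := fun i => hf.pderiv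
  refine mem_relationSpace.2 ⟨IsHomogeneous.sum _ _ _ fun i _ => ?_,
    fun i => add_mem ?_ (sum_mem fun j _ => ?_)⟩
  · exact mem_shiftedPiece_zero.1 (mul_mem_shiftedPiece (e' := 0) (t.1 i).2 (hp i))
  · exact mul_mem_shiftedPiece_add (t.1 i).2 (by simpa using hx.pow l)
  · exact mul_mem_shiftedPiece (sub_mem (t.2 i j).2 (t.2 j i).2) (hp j)

/-- A multiple of the Fermat polynomial, with partial derivatives `X i ^ (d - 1)`. -/
def fermat (n d : ℕ) : S n := ∑ i, C (d : ℂ)⁻¹ * X i ^ d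

theorem fermat_isHomogeneous : (fermat n d).IsHomogeneous d :=
  IsHomogeneous.sum _ _ _ fun i _ => (isHomogeneous_X_pow i d).C_mul _

theorem pderiv_fermat (a : ℕ) (i : Fin (n + 1)) : pderiv i (fermat n (a + 1)) = X i ^ a := by
  have ha : ((a + 1 : ℕ) : ℂ) ≠ 0 := Nat.cast_ne_zero.2 a.succ_ne_zero
  rw [fermat, map_sum, Finset.sum_eq_single i]
  · rw [pderiv_C_mul, pderiv_pow, pderiv_X_self, mul_one, ← mul_assoc, ← map_natCast C,
      ← C_mul, inv_mul_cancel₀ ha, C_1, one_mul, Nat.add_sub_cancel]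
  · intro j _ hj
    rw [pderiv_C_mul, pderiv_pow, pderiv_X_of_ne hj, mul_zero, mul_zero]
  · simp

theorem exists_trivialRelation_fermat {b k l : ℕ} (hkl : 2 * k + l ≤ (b + 1) * (n + 1))
    {y : S n × (Fin (n + 1) → S n)} (hy : y ∈ relationSpace n k (k + l) (b + 2))
    (h : relationMap l (fermat n (b + 3)) (∑ i, X i) y = 0) :
    ∃ t : TrivialRelation n k (k + l) (b + 2),
      trivialRelation l (fermat n (b + 3)) (∑ i, X i) t = y := by
  obtain ⟨p, e⟩ := y
  obtain ⟨hp, he⟩ := mem_relationSpace.1 hy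
  have hpd := pderiv_fermat (n := n) (b + 2)
  simp only [relationMap_apply, hpd, sub_eq_zero] at h
  have hmem : p ∈ powIdeal (Fin (n + 1)) (b + 2) := by
    refine mem_powIdeal_of_sum_X_pow_mul_mem (l := l) hp (by simpa using hkl) ?_
    rw [h]
    exact sum_mem fun i _ => Ideal.mul_mem_left _ _ (X_pow_mem_powIdeal i _)
  obtain ⟨c, hc, rfl⟩ := exists_shifted_of_mem_powIdeal hp hmem
  have hX : ((∑ i, X i : S n) ^ l).IsHomogeneous l := by
    simpa using (IsHomogeneous.sum Finset.univ _ 1 fun i _ => isHomogeneous_X ℂ i :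
      (∑ i, X i : S n).IsHomogeneous 1).pow l
  obtain ⟨q, hq, hqe⟩ := exists_shifted_koszul (e := fun i => e i - (∑ i, X i) ^ l * c i)
    (fun i => sub_mem (he i) (mul_mem_shiftedPiece_add (hc i) hX)) (by
      simp only [sub_mul, Finset.sum_sub_distrib, ← h, Finset.mul_sum, mul_assoc, sub_self])
  refine ⟨(fun i => ⟨c i, hc i⟩, fun i j => ⟨q i j, hq i j⟩), ?_⟩
  refine Prod.ext ?_ (funext fun i => ?_)
  · simp only [trivialRelation, hpd]
  · simp only [trivialRelation, hpd, ← hqe i]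
    ring

theorem mem_jacobianIdeal_of_exact {a k l : ℕ} {f x p : S n} (hf : f.IsHomogeneous (a + 1))
    (hx : x.IsHomogeneous 1) (hp : p.IsHomogeneous k)
    (hex : ∀ y ∈ relationSpace n k (k + l) a, relationMap l f x y = 0 → y ∈ Submodule.span ℂ
      (Set.range (trivialRelation (k := k) (m := k + l) (a := a) l f x)))
    (h : x ^ l * p ∈ jacobianIdeal f) : p ∈ jacobianIdeal f := by
  have hpd : ∀ i, (pderiv i f).IsHomogeneous a := fun i => hf.pderiv
  have hpl : (x ^ l * p).IsHomogeneous (k + l) := by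
    simpa [add_comm] using (hx.pow l).mul hp
  obtain ⟨c, hc⟩ := Ideal.mem_span_range_iff_exists_fun.1 h
  have hy := hex (p, fun i => shiftedComponent (k + l) a (c i))
    (mem_relationSpace.2 ⟨hp, fun i => shiftedComponent_mem _ _ _⟩) (by
      rw [relationMap_apply, sub_eq_zero]
      have := congrArg (homogeneousComponent (k + l)) hc
      rw [homogeneousComponent_eq_self hpl, map_sum] at this
      rw [← this]
      exact Finset.sum_congr rfl fun i _ => homogeneousComponent_mul_of_isHomogeneous_s8 (hpd i) _ _)
  have hle : Submodule.span ℂ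
      (Set.range (trivialRelation (k := k) (m := k + l) (a := a) l f x)) ≤
      ((jacobianIdeal f).restrictScalars ℂ).comap (LinearMap.fst ℂ _ _) := by
    refine Submodule.span_le.2 ?_
    rintro _ ⟨t, rfl⟩
    change ∑ i, (t.1 i : S n) * pderiv i f ∈ jacobianIdeal f
    exact sum_mem fun i _ => Ideal.mul_mem_left _ _ (Ideal.subset_span ⟨i, rfl⟩)
  exact hle hy

/-- The parameter space of pairs of a form of degree `d` and a linear form. -/
abbrev FormPair (n d : ℕ) : Type :=
  homogeneousSubmodule (Fin (n + 1)) ℂ d × homogeneousSubmodule (Fin (n + 1)) ℂ 1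

instance (k : ℕ) : FiniteDimensional ℂ (homogeneousSubmodule (Fin (n + 1)) ℂ k) :=
  Module.Finite.iff_fg.2 (homogeneousSubmodule_fg _ _ _)

theorem pderiv_mem_polyMap (i : Fin (n + 1)) :
    (fun z : FormPair n d => pderiv i (z.1 : S n)) ∈ polyMap (FormPair n d) (S n) :=
  comp_mem_polyMap (pderiv i).toLinearMap (F := fun z : FormPair n d => (z.1 : S n))
    (linearMap_mem_polyMap ((homogeneousSubmodule (Fin (n + 1)) ℂ d).subtype.comp
      (LinearMap.fst ℂ _ (homogeneousSubmodule (Fin (n + 1)) ℂ 1))))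

theorem linear_form_pow_mem_polyMap (l : ℕ) :
    (fun z : FormPair n d => (z.2 : S n) ^ l) ∈ polyMap (FormPair n d) (S n) :=
  pow_mem_polyMap (F := fun z : FormPair n d => (z.2 : S n))
    (linearMap_mem_polyMap ((homogeneousSubmodule (Fin (n + 1)) ℂ 1).subtype.comp
      (LinearMap.snd ℂ (homogeneousSubmodule (Fin (n + 1)) ℂ d) _))) l

theorem trivialRelation_mem_polyMap {k m a : ℕ} (l : ℕ) (t : TrivialRelation n k m a) :
    (fun z : FormPair n d => trivialRelation l (z.1 : S n) z.2 t) ∈ polyMap (FormPair n d) _ := by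
  refine prodMk_mem_polyMap (sum_mem_polyMap _ fun i _ =>
    mul_mem_polyMap (const_mem_polyMap _) (pderiv_mem_polyMap i)) (pi_mem_polyMap fun i => ?_)
  exact add_mem (mul_mem_polyMap (linear_form_pow_mem_polyMap l) (const_mem_polyMap _))
    (sum_mem_polyMap _ fun j _ => mul_mem_polyMap (const_mem_polyMap _) (pderiv_mem_polyMap j))

theorem relationMap_mem_polyMap (l : ℕ) (y : S n × (Fin (n + 1) → S n)) :
    (fun z : FormPair n d => relationMap l (z.1 : S n) z.2 y) ∈ polyMap (FormPair n d) (S n) := by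
  simp only [relationMap_apply]
  exact sub_mem (mul_mem_polyMap (linear_form_pow_mem_polyMap l) (const_mem_polyMap _))
    (sum_mem_polyMap _ fun i _ => mul_mem_polyMap (const_mem_polyMap _) (pderiv_mem_polyMap i))

/-- The Fermat polynomial and the sum of the variables, as a point of the parameter space. -/
def fermatPair (n d : ℕ) : FormPair n d :=
  (⟨fermat n d, fermat_isHomogeneous⟩,
    ⟨∑ i, X i, IsHomogeneous.sum _ _ _ fun i _ => isHomogeneous_X ℂ i⟩)

theorem exists_isPolyFun_injective (n b k l : ℕ) :
    ∃ φ : FormPair n (b + 3) → ℂ, IsPolyFun φ ∧ φ (fermatPair n (b + 3)) ≠ 0 ∧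
      ∀ z, φ z ≠ 0 → 2 * k + l ≤ (b + 1) * (n + 1) → ∀ p : S n, p.IsHomogeneous k →
        (z.2 : S n) ^ l * p ∈ jacobianIdeal (z.1 : S n) → p ∈ jacobianIdeal (z.1 : S n) := by
  by_cases hkl : 2 * k + l ≤ (b + 1) * (n + 1)
  · have hex : ∀ y ∈ relationSpace n k (k + l) (b + 2),
        relationMap l (fermat n (b + 3)) (∑ i, X i) y = 0 → y ∈ Submodule.span ℂ (Set.range
          (trivialRelation (k := k) (m := k + l) (a := b + 2) l (fermat n (b + 3)) (∑ i, X i))) :=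
      fun y hy h => Submodule.subset_span (exists_trivialRelation_fermat hkl hy h)
    let v : FormPair n (b + 3) → TrivialRelation n k (k + l) (b + 2) → S n × (Fin (n + 1) → S n) :=
      fun z => trivialRelation l (z.1 : S n) z.2
    let β : FormPair n (b + 3) → S n × (Fin (n + 1) → S n) →ₗ[ℂ] S n :=
      fun z => relationMap l (z.1 : S n) z.2
    have hvB : ∀ z t, v z t ∈ relationSpace n k (k + l) (b + 2) := fun z t =>
      trivialRelation_mem z.1.2 z.2.2 t
    have hβv : ∀ z t, β z (v z t) = 0 := fun z t =>
      relationMap_trivialRelation l (z.1 : S n) (z.2 : S n) t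
    obtain ⟨φ, hφ, hφ₀, H⟩ := exists_isPolyFun_exact (relationSpace n k (k + l) (b + 2)) v β hvB hβv
      (fun t => trivialRelation_mem_polyMap l t) (fun y => relationMap_mem_polyMap l y)
      (z₀ := fermatPair n (b + 3)) hex
    exact ⟨φ, hφ, hφ₀, fun z hz _ p hp h =>
      mem_jacobianIdeal_of_exact z.1.2 z.2.2 hp (H z hz) h⟩
  · exact ⟨1, one_mem _, one_ne_zero, fun z _ h => absurd h hkl⟩

end Generic

/-- Lemma on injectivity of multiplication by powers of a linear form.
For `d ≥ 3`, `n ≥ 1` and generic `(f, x) ∈ S^d × S¹`: for all `k` and `l ≥ 1` with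
`2k + l ≤ (d-2)(n+1)`, multiplication by `x^l` is injective from `R_f^k` to `R_f^{k+l}`. -/
theorem mult_by_power_injective_generic (n d : ℕ) (hd : 3 ≤ d) (hn : 1 ≤ n) :
    GenericallyHolds (fun fx : (MvPolynomial.homogeneousSubmodule (Fin (n + 1)) ℂ d) ×
        (MvPolynomial.homogeneousSubmodule (Fin (n + 1)) ℂ 1) =>
      ∀ k l : ℕ, 1 ≤ l → 2 * k + l ≤ (d - 2) * (n + 1) →
        ∀ p : S n, p.IsHomogeneous k →
          (fx.2 : S n) ^ l * p ∈ jacobianIdeal (fx.1 : S n) →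
          p ∈ jacobianIdeal (fx.1 : S n)) := by
  obtain ⟨b, rfl⟩ := Nat.exists_eq_add_of_le' hd
  choose φ hφ hφ₀ H using exists_isPolyFun_injective n b
  let N := (b + 1) * (n + 1) + 1
  refine ⟨∏ k ∈ Finset.range N, ∏ l ∈ Finset.range N, φ k l,
    prod_mem fun k _ => prod_mem fun l _ => hφ k l, ⟨fermatPair n (b + 3), ?_⟩, ?_⟩
  · simp only [Finset.prod_apply]
    exact Finset.prod_ne_zero_iff.2 fun k _ => Finset.prod_ne_zero_iff.2 fun l _ => hφ₀ k l
  · intro z hz k l _ hkl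
    replace hkl : 2 * k + l ≤ (b + 1) * (n + 1) := hkl
    simp only [Finset.prod_apply, Finset.prod_ne_zero_iff, Finset.mem_range] at hz
    exact H k l z (hz k (by omega) l (by omega)) hkl

end
end
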